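/- arXiv:2404.08316 — 2 statements merged into one kernel-verified Lean document; each statement's English description precedes it below -/
import Mathlib

section
/- (Lemma B.3: existence and uniqueness for the forward system.) Let the model data satisfy the Lipschitz assumptions, and let v ∈ V be given. Then there exists a unique regular function μ : TS → ℝ^S satisfying (E2), the initial condition (E4) and the consistency conditions (E5). Moreover this solution satisfies μ(t,u) ∈ 𝒫(𝕊) for all (t,u) ∈ TS and μ(·,u) is Qmax-Lipschitz continuous for every u ∈ 𝕌, i.e. μ ∈ M. -/
open MeasureTheory
open scoped BigOperators Classical

namespace MFGShocks

/-- The probability simplex `𝒫(𝕊)` in `ℝ^S`. -/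
def simplex (S : ℕ) : Set (Fin S → ℝ) :=
  {m | (∀ i, 0 ≤ m i) ∧ ∑ i, m i = 1}

/-- Membership in the parameter set `𝕌`: for some `k ≤ n`, the first `k` coordinates are
increasing and lie in `[0,T]` and the remaining coordinates equal `-1`. -/
def memU (n : ℕ) (T : ℝ) (u : Fin n → ℝ) : Prop :=
  ∃ k ≤ n, (∀ i : Fin n, (i : ℕ) < k → u i ∈ Set.Icc (0 : ℝ) T) ∧
    (∀ i j : Fin n, (j : ℕ) < k → i ≤ j → u i ≤ u j) ∧
    (∀ i : Fin n, k ≤ (i : ℕ) → u i = -1)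

/-- `Z(u)`: the number of coordinates of `u` different from `-1`, i.e.\ the number of
shocks recorded in `u`. -/
noncomputable def Zu {n : ℕ} (u : Fin n → ℝ) : ℕ :=
  (Finset.univ.filter fun i => u i ≠ -1).card

/-- Membership `(t,u) ∈ TS`. -/
def memTS (n : ℕ) (T : ℝ) (t : ℝ) (u : Fin n → ℝ) : Prop :=
  memU n T u ∧ t ∈ Set.Icc (0 : ℝ) T ∧ ∀ i, u i ≤ t

/-- `→(u,t)`: record a new shock at time `t` (replace coordinate `Z(u)+1` of `u` by `t`). -/
noncomputable def push {n : ℕ} (u : Fin n → ℝ) (t : ℝ) : Fin n → ℝ :=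
  fun i => if (i : ℕ) = Zu u then t else u i

/-- `←u`: delete the last shock (replace coordinate `Z(u)` of `u` by `-1`). -/
noncomputable def pop {n : ℕ} (u : Fin n → ℝ) : Fin n → ℝ :=
  fun i => if (i : ℕ) + 1 = Zu u then -1 else u i

/-- `t_u = u^{Z(u)}`: the time of the last shock recorded in `u` (`0` if there is none). -/
noncomputable def lastTime {n : ℕ} (u : Fin n → ℝ) : ℝ :=
  if h : Zu u - 1 < n then u ⟨Zu u - 1, h⟩ else 0

/-- The left endpoint of the time interval associated with the parameter `u`:
`t_u` if `u` records at least one shock, and `0` otherwise. -/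
noncomputable def startTime {n : ℕ} (u : Fin n → ℝ) : ℝ :=
  if Zu u = 0 then 0 else lastTime u

/-- `f` is absolutely continuous on the interval `[a,b]`. -/
def AbsContOn {E : Type*} [NormedAddCommGroup E] (f : ℝ → E) (a b : ℝ) : Prop :=
  ∀ ε > (0 : ℝ), ∃ δ > (0 : ℝ), ∀ (N : ℕ) (c d : Fin N → ℝ),
    (∀ k, a ≤ c k ∧ c k ≤ d k ∧ d k ≤ b) →
    (∀ k l, k ≠ l → Set.Ioo (c k) (d k) ∩ Set.Ioo (c l) (d l) = ∅) →
    ∑ k, (d k - c k) < δ → ∑ k, ‖f (d k) - f (c k)‖ < ε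

/-- A function `f : TS → ℝ^S` is regular if `f(·,u)` is absolutely continuous on
`[max_k u^k, T]` (intersected with `[0,T]`) for every `u ∈ 𝕌`. -/
def Regular (S n : ℕ) (T : ℝ) (f : ℝ → (Fin n → ℝ) → Fin S → ℝ) : Prop :=
  ∀ u : Fin n → ℝ, memU n T u → AbsContOn (fun t => f t u) (startTime u) T

/-- The model data: reduced-form running reward `ψ̂`, reduced-form intensity matrix `Q̂`,
shock intensities `λ`, terminal reward `Ψ`, relocation map `J` (independent of the
distribution) and initial distribution `m₀`. -/
structure Model (S n : ℕ) where
  psi : ℝ → (Fin n → ℝ) → (Fin S → ℝ) → (Fin S → ℝ) → Fin S → ℝ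
  Q : ℝ → (Fin n → ℝ) → (Fin S → ℝ) → (Fin S → ℝ) → Fin S → Fin S → ℝ
  lam : ℕ → ℝ → (Fin S → ℝ) → ℝ
  Psi : ℕ → (Fin S → ℝ) → Fin S → ℝ
  J : ℝ → Fin S → Fin S
  m0 : Fin S → ℝ

/-- The standing (boundedness, measurability, intensity-matrix and Lipschitz) assumptions on
the model data, together with the constants `Ψmax, ψmax, Qmax, λmax, Jmax` bounding the data
and the Lipschitz constants `L_ψ̂, L_Q̂, L_Ψ, L_λ`.  Throughout, `ℝ^S` carries the maximum
norm and the matrix norm is the compatible induced one (maximal absolute row sum). -/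
structure Hyps (S n : ℕ) (T : ℝ) (D : Model S n)
    (Lpsi LQ LPsi Llam Psimax psimax Qmax lammax : ℝ) (Jmax : ℕ) : Prop where
  hS : 1 ≤ S
  hn : 1 ≤ n
  hT : 0 < T
  hm0 : D.m0 ∈ simplex S
  hLpsi : 0 < Lpsi
  hLQ : 0 < LQ
  hLPsi : 0 < LPsi
  hLlam : 0 < Llam
  psi_meas : Measurable fun p : ℝ × (Fin n → ℝ) × (Fin S → ℝ) × (Fin S → ℝ) =>
    D.psi p.1 p.2.1 p.2.2.1 p.2.2.2
  Q_meas : Measurable fun p : ℝ × (Fin n → ℝ) × (Fin S → ℝ) × (Fin S → ℝ) =>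
    D.Q p.1 p.2.1 p.2.2.1 p.2.2.2
  lam_meas : ∀ k, Measurable fun p : ℝ × (Fin S → ℝ) => D.lam k p.1 p.2
  Psi_meas : ∀ k, Measurable (D.Psi k)
  J_meas : Measurable D.J
  psi_bdd : ∀ t u m v, memTS n T t u → m ∈ simplex S → ∀ i, |D.psi t u m v i| ≤ psimax
  Q_bdd : ∀ t u m v, memTS n T t u → m ∈ simplex S → ∀ i, ∑ j, |D.Q t u m v i j| ≤ Qmax
  Q_offdiag : ∀ t u m v i j, i ≠ j → 0 ≤ D.Q t u m v i j
  Q_rowsum : ∀ t u m v i, ∑ j, D.Q t u m v i j = 0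
  lam_pos : ∀ k, 1 ≤ k → k ≤ n → ∀ t ∈ Set.Icc (0 : ℝ) T, ∀ m ∈ simplex S,
    0 < D.lam k t m
  lam_bdd : ∀ k, 1 ≤ k → k ≤ n → ∀ t ∈ Set.Icc (0 : ℝ) T, ∀ m ∈ simplex S,
    D.lam k t m ≤ lammax
  Psi_bdd : ∀ k ≤ n, ∀ m ∈ simplex S, ∀ i, |D.Psi k m i| ≤ Psimax
  psi_lip : ∀ t u, memTS n T t u → ∀ m₁ ∈ simplex S, ∀ m₂ ∈ simplex S,
    ∀ v₁ v₂ : Fin S → ℝ, ∀ i,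
      |D.psi t u m₁ v₁ i - D.psi t u m₂ v₂ i| ≤ Lpsi * (‖m₁ - m₂‖ + ‖v₁ - v₂‖)
  Q_lip : ∀ t u, memTS n T t u → ∀ m₁ ∈ simplex S, ∀ m₂ ∈ simplex S,
    ∀ v₁ v₂ : Fin S → ℝ, ∀ i,
      ∑ j, |D.Q t u m₁ v₁ i j - D.Q t u m₂ v₂ i j| ≤ LQ * (‖m₁ - m₂‖ + ‖v₁ - v₂‖)
  Psi_lip : ∀ k ≤ n, ∀ m₁ ∈ simplex S, ∀ m₂ ∈ simplex S,
    ‖D.Psi k m₁ - D.Psi k m₂‖ ≤ LPsi * ‖m₁ - m₂‖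
  lam_lip : ∀ k, 1 ≤ k → k ≤ n → ∀ t ∈ Set.Icc (0 : ℝ) T, ∀ m₁ ∈ simplex S, ∀ m₂ ∈ simplex S,
    |D.lam k t m₁ - D.lam k t m₂| ≤ Llam * ‖m₁ - m₂‖
  J_bdd : ∀ t ∈ Set.Icc (0 : ℝ) T, ∀ j : Fin S,
    (Finset.univ.filter fun i => D.J t i = j).card ≤ Jmax

/-- The constant `v_max`. -/
noncomputable def vmaxC (n : ℕ) (T Psimax psimax Qmax lammax : ℝ) : ℝ :=
  (Psimax + psimax * T) * Real.exp ((Qmax + lammax) * T) *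
    ∑ i ∈ Finset.range (n + 1), (Real.exp ((Qmax + lammax) * T) * lammax * T) ^ i

/-- The constant `K₁ = L_ψ̂ + L_Q̂ v_max + 2 v_max L_λ`. -/
noncomputable def K1C (n : ℕ) (T Lpsi LQ Llam Psimax psimax Qmax lammax : ℝ) : ℝ :=
  Lpsi + LQ * vmaxC n T Psimax psimax Qmax lammax +
    2 * vmaxC n T Psimax psimax Qmax lammax * Llam

/-- The constant `K₂ = L_ψ̂ + v_max L_Q̂ + Qmax + λmax`. -/
noncomputable def K2C (n : ℕ) (T Lpsi LQ Psimax psimax Qmax lammax : ℝ) : ℝ :=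
  Lpsi + vmaxC n T Psimax psimax Qmax lammax * LQ + Qmax + lammax

/-- The right-hand side of the backward equation (E1), written for the integral
(Carathéodory) formulation `v(t,u) = Ψ(Z(u),μ(T,u)) + ∫_t^T (E1rhs)(s) ds`. -/
noncomputable def E1rhs {S n : ℕ} (D : Model S n)
    (μ v : ℝ → (Fin n → ℝ) → Fin S → ℝ) (u : Fin n → ℝ) (i : Fin S) (s : ℝ) : ℝ :=
  D.psi s u (μ s u) (v s u) i + (∑ j, D.Q s u (μ s u) (v s u) i j * v s u j) +
    (if Zu u < n then
      D.lam (Zu u + 1) s (μ s u) * (v s (push u s) (D.J s i) - v s u i)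
    else 0)

/-- `v` is a (Carathéodory) solution of the backward equation (E1) with terminal
condition (E3), given the flow `μ`. -/
def SolBackward (S n : ℕ) (T : ℝ) (D : Model S n)
    (μ v : ℝ → (Fin n → ℝ) → Fin S → ℝ) : Prop :=
  ∀ u : Fin n → ℝ, memU n T u →
    (∀ i : Fin S, v T u i = D.Psi (Zu u) (μ T u) i) ∧
    ∀ t : ℝ, memTS n T t u → ∀ i : Fin S,
      IntervalIntegrable (E1rhs D μ v u i) volume t T ∧
      v t u i = D.Psi (Zu u) (μ T u) i + ∫ s in t..T, E1rhs D μ v u i s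

/-- The right-hand side of the forward equation (E2). -/
noncomputable def E2rhs {S n : ℕ} (D : Model S n)
    (v μ : ℝ → (Fin n → ℝ) → Fin S → ℝ) (u : Fin n → ℝ) (i : Fin S) (s : ℝ) : ℝ :=
  ∑ j, μ s u j * D.Q s u (μ s u) (v s u) j i

/-- `μ` is a (Carathéodory) solution of the forward equation (E2) with initial
condition (E4) and consistency conditions (E5), given the value function `v`. -/
def SolForward (S n : ℕ) (T : ℝ) (D : Model S n)
    (v μ : ℝ → (Fin n → ℝ) → Fin S → ℝ) : Prop :=
  (∀ i, μ 0 (fun _ => (-1 : ℝ)) i = D.m0 i) ∧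
  (∀ u : Fin n → ℝ, memU n T u → 1 ≤ Zu u → ∀ j : Fin S,
    μ (lastTime u) u j =
      ∑ i, if D.J (lastTime u) i = j then μ (lastTime u) (pop u) i else 0) ∧
  (∀ u : Fin n → ℝ, memU n T u → ∀ t : ℝ, memTS n T t u → ∀ i : Fin S,
    IntervalIntegrable (E2rhs D v μ u i) volume (startTime u) t ∧
    μ t u i = μ (startTime u) u i + ∫ s in (startTime u)..t, E2rhs D v μ u i s)

/-- Membership in `M`: a `𝒫(𝕊)`-valued function on `TS` that is `Qmax`-Lipschitz in time. -/
def MemM (S n : ℕ) (T Qmax : ℝ) (μ : ℝ → (Fin n → ℝ) → Fin S → ℝ) : Prop :=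
  (∀ t u, memTS n T t u → μ t u ∈ simplex S) ∧
  ∀ u : Fin n → ℝ, memU n T u → ∀ t₁ t₂ : ℝ, memTS n T t₁ u → memTS n T t₂ u →
    ‖μ t₁ u - μ t₂ u‖ ≤ Qmax * |t₁ - t₂|

/-- Membership in `V`: a regular function on `TS` bounded by `v_max` in supremum norm. -/
def MemV (S n : ℕ) (T vmaxVal : ℝ) (v : ℝ → (Fin n → ℝ) → Fin S → ℝ) : Prop :=
  Regular S n T v ∧ ∀ t u, memTS n T t u → ‖v t u‖ ≤ vmaxVal

/-- The supremum norm over `TS` of a function `f : TS → ℝ^S`. -/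
noncomputable def supTS (S n : ℕ) (T : ℝ) (f : ℝ → (Fin n → ℝ) → Fin S → ℝ) : ℝ :=
  sSup {r : ℝ | ∃ t u, memTS n T t u ∧ r = ‖f t u‖}

end MFGShocks

namespace MFGShocks

theorem intervalIntegrable_of_measurable_of_norm_le {E : Type*} [NormedAddCommGroup E]
    [MeasurableSpace E] [BorelSpace E] [SecondCountableTopology E] {f : ℝ → E}
    (hf : Measurable f) {B : ℝ} (hB : ∀ s, ‖f s‖ ≤ B) (a b : ℝ) :
    IntervalIntegrable f volume a b :=
  (intervalIntegrable_const (c := B)).mono_fun hf.aestronglyMeasurable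
    (Filter.Eventually.of_forall fun s => (hB s).trans (le_abs_self B))

theorem integral_exp_mul_sub_le {K : ℝ} (hK : 0 < K) (a t : ℝ) :
    ∫ s in a..t, Real.exp (K * (s - a)) ≤ Real.exp (K * (t - a)) / K := by
  have h : ∫ s in a..t, Real.exp (K * (s - a)) =
      Real.exp (K * (t - a)) / K - Real.exp (K * (a - a)) / K := by
    refine intervalIntegral.integral_eq_sub_of_hasDerivAt
      (f := fun s => Real.exp (K * (s - a)) / K) (fun s _ => ?_)
      (Continuous.intervalIntegrable (by fun_prop) _ _)
    have h1 : HasDerivAt (fun s => K * (s - a)) K s := by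
      simpa using ((hasDerivAt_id s).sub_const a).const_mul K
    have h2 := h1.exp.div_const K
    rwa [mul_div_cancel_right₀ _ hK.ne'] at h2
  rw [h]
  have : 0 < Real.exp (K * (a - a)) / K := by positivity
  linarith

/-- Existence and uniqueness for Carathéodory equations with a bounded right-hand side that is
globally Lipschitz in space. -/
theorem exists_unique_caratheodory {E : Type*} [NormedAddCommGroup E] [NormedSpace ℝ E]
    [CompleteSpace E] [MeasurableSpace E] [BorelSpace E] [SecondCountableTopology E]
    {F : ℝ → E → E} (hF : Measurable (Function.uncurry F)) {B L : ℝ}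
    (hB : ∀ s x, ‖F s x‖ ≤ B) (hL0 : 0 ≤ L) (hL : ∀ s x y, ‖F s x - F s y‖ ≤ L * ‖x - y‖)
    {a b : ℝ} (hab : a ≤ b) (m : E) :
    ∃ x : ℝ → E, Continuous x ∧
      (∀ t ∈ Set.Icc a b, x t = m + ∫ s in a..t, F s (x s)) ∧
      ∀ y : ℝ → E, ContinuousOn y (Set.Icc a b) →
        (∀ t ∈ Set.Icc a b, y t = m + ∫ s in a..t, F s (y s)) →
        ∀ t ∈ Set.Icc a b, y t = x t := by
  obtain ⟨K, hK, hLK⟩ : ∃ K : ℝ, 0 < K ∧ L / K ≤ 1 / 2 := by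
    refine ⟨2 * L + 1, by positivity, ?_⟩
    rw [div_le_iff₀ (by positivity)]
    linarith
  have hmeas : ∀ z : ℝ → E, Continuous z → Measurable fun s => F s (z s) := fun z hz =>
    hF.comp (measurable_id.prodMk hz.measurable)
  have hint : ∀ z : ℝ → E, Continuous z → ∀ c d,
      IntervalIntegrable (fun s => F s (z s)) volume c d := fun z hz c d =>
    intervalIntegrable_of_measurable_of_norm_le (hmeas z hz) (fun s => hB _ _) c d
  -- undo the exponential weight
  let w : C(Set.Icc a b, E) → ℝ → E := fun z s => Real.exp (K * (s - a)) • Set.IccExtend hab z s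
  have hw : ∀ z, Continuous (w z) := fun z => by
    have : Continuous (Set.IccExtend hab z) := z.continuous.Icc_extend'
    fun_prop
  have hprim : ∀ z, Continuous fun t => ∫ s in a..t, F s (w z s) := fun z =>
    intervalIntegral.continuous_primitive (hint _ (hw z)) a
  let Φ : C(Set.Icc a b, E) → C(Set.Icc a b, E) := fun z =>
    ⟨fun t => Real.exp (-(K * ((t : ℝ) - a))) • (m + ∫ s in a..t, F s (w z s)), by
      have : Continuous fun t : Set.Icc a b => ∫ s in a..(t : ℝ), F s (w z s) :=
        (hprim z).comp continuous_subtype_val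
      fun_prop⟩
  have hΦ : ContractingWith (1 / 2) Φ := by
    refine ⟨by norm_num, LipschitzWith.of_dist_le_mul fun z₁ z₂ => ?_⟩
    rw [ContinuousMap.dist_le (by positivity)]
    rintro ⟨t, ht⟩
    change dist (Real.exp (-(K * (t - a))) • (m + ∫ s in a..t, F s (w z₁ s)))
      (Real.exp (-(K * (t - a))) • (m + ∫ s in a..t, F s (w z₂ s))) ≤ _
    rw [dist_smul₀, dist_add_left, dist_eq_norm,
      ← intervalIntegral.integral_sub (hint _ (hw z₁) _ _) (hint _ (hw z₂) _ _),
      Real.norm_of_nonneg (Real.exp_pos _).le]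
    have h1 : ‖∫ s in a..t, (F s (w z₁ s) - F s (w z₂ s))‖ ≤
        ∫ s in a..t, (L * dist z₁ z₂) * Real.exp (K * (s - a)) := by
      refine intervalIntegral.norm_integral_le_of_norm_le ht.1
        (Filter.Eventually.of_forall fun s _ => ?_)
        (Continuous.intervalIntegrable (by fun_prop) _ _)
      refine (hL _ _ _).trans ?_
      have : ‖w z₁ s - w z₂ s‖ ≤ Real.exp (K * (s - a)) * dist z₁ z₂ := by
        simp only [w, ← smul_sub, norm_smul, Real.norm_of_nonneg (Real.exp_pos _).le]
        gcongr
        rw [← dist_eq_norm]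
        exact ContinuousMap.dist_apply_le_dist _
      calc L * ‖w z₁ s - w z₂ s‖ ≤ L * (Real.exp (K * (s - a)) * dist z₁ z₂) := by gcongr
        _ = _ := by ring
    rw [intervalIntegral.integral_const_mul] at h1
    calc _ ≤ Real.exp (-(K * (t - a))) *
          ((L * dist z₁ z₂) * (Real.exp (K * (t - a)) / K)) := by
            gcongr
            refine h1.trans ?_
            gcongr
            exact integral_exp_mul_sub_le hK a t
      _ = L / K * dist z₁ z₂ * (Real.exp (-(K * (t - a))) * Real.exp (K * (t - a))) := by ring
      _ = L / K * dist z₁ z₂ := by rw [← Real.exp_add]; simp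
      _ ≤ 1 / 2 * dist z₁ z₂ := by gcongr
      _ = _ := by simp
  set z := hΦ.fixedPoint Φ with hz
  have hfix : Φ z = z := hΦ.fixedPoint_isFixedPt
  refine ⟨w z, hw z, fun t ht => ?_, fun y hy hyeq t ht => ?_⟩
  · have h1 : z ⟨t, ht⟩ = Real.exp (-(K * (t - a))) • (m + ∫ s in a..t, F s (w z s)) :=
      (DFunLike.congr_fun hfix ⟨t, ht⟩).symm
    change Real.exp (K * (t - a)) • Set.IccExtend hab z t = _
    rw [Set.IccExtend_of_mem hab _ ht, h1, smul_smul, ← Real.exp_add]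
    simp
  · have hcont : Continuous fun t : Set.Icc a b =>
        Real.exp (-(K * ((t : ℝ) - a))) • y t := by
      have : Continuous fun t : Set.Icc a b => y t :=
        continuousOn_iff_continuous_domRestrict.1 hy
      exact Continuous.smul (by fun_prop) this
    let z' : C(Set.Icc a b, E) := ⟨_, hcont⟩
    have hwz' : ∀ s ∈ Set.Icc a b, w z' s = y s := fun s hs => by
      change Real.exp (K * (s - a)) • Set.IccExtend hab z' s = _
      rw [Set.IccExtend_of_mem hab _ hs]
      change Real.exp (K * (s - a)) • Real.exp (-(K * (s - a))) • y s = _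
      rw [smul_smul, ← Real.exp_add]
      simp
    have hfix' : Φ z' = z' := by
      ext ⟨t, ht⟩
      change Real.exp (-(K * (t - a))) • (m + ∫ s in a..t, F s (w z' s)) =
        Real.exp (-(K * (t - a))) • y t
      rw [hyeq t ht]
      congr 2
      refine intervalIntegral.integral_congr fun s hs => ?_
      rw [Set.uIcc_of_le ht.1] at hs
      simp only [hwz' s ⟨hs.1, hs.2.trans ht.2⟩]
    have : z' = z := hΦ.fixedPoint_unique hfix'
    rw [← hwz' t ht, this]

theorem deriv_abs_comp {f : ℝ → ℝ} {f' x : ℝ} (hf : HasDerivAt f f' x) :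
    deriv (fun t => |f t|) x = Real.sign (f x) * f' := by
  rcases lt_trichotomy (f x) 0 with h | h | h
  · rw [Real.sign_of_neg h]
    exact ((hasDerivAt_abs_neg h).comp x hf).deriv
  · rw [h, Real.sign_zero, zero_mul]
    refine IsLocalMin.deriv_eq_zero (Filter.Eventually.of_forall fun t => ?_)
    simp [h]
  · rw [Real.sign_of_pos h]
    exact ((hasDerivAt_abs_pos h).comp x hf).deriv

theorem absolutelyContinuousOnInterval_abs {f : ℝ → ℝ} {a b : ℝ}
    (hf : AbsolutelyContinuousOnInterval f a b) :
    AbsolutelyContinuousOnInterval (fun t => |f t|) a b := by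
  rw [absolutelyContinuousOnInterval_iff] at hf ⊢
  intro ε hε
  obtain ⟨δ, hδ, h⟩ := hf ε hε
  refine ⟨δ, hδ, fun E hE hEδ => lt_of_le_of_lt (Finset.sum_le_sum fun i _ => ?_) (h E hE hEδ)⟩
  exact abs_abs_sub_abs_le _ _

/-- The `ℓ¹`-norm of an absolutely continuous curve with derivative `g` does not increase if `g`
pairs nonpositively with the signs of the coordinates. -/
theorem sum_abs_le_of_sign_mul_nonpos {ι : Type*} [Fintype ι] {f g : ι → ℝ → ℝ} {a b : ℝ}
    (hab : a ≤ b) (hg : ∀ i, IntervalIntegrable (g i) volume a b)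
    (hf : ∀ i, ∀ t ∈ Set.Icc a b, f i t = f i a + ∫ s in a..t, g i s)
    (hs : ∀ t ∈ Set.Icc a b, ∑ i, Real.sign (f i t) * g i t ≤ 0) :
    ∑ i, |f i b| ≤ ∑ i, |f i a| := by
  let P : ι → ℝ → ℝ := fun i t => f i a + ∫ s in a..t, g i s
  have hPa : ∀ i, P i a = f i a := fun i => by simp [P]
  have hP : ∀ i, AbsolutelyContinuousOnInterval (P i) a b := fun i => by
    have h1 : AbsolutelyContinuousOnInterval (fun _ : ℝ => f i a) a b :=
      (LipschitzWith.const (f i a)).lipschitzOnWith.absolutelyContinuousOnInterval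
    exact h1.add ((hg i).absolutelyContinuousOnInterval_intervalIntegral (by simp))
  have hA : ∀ i, AbsolutelyContinuousOnInterval (fun t => |P i t|) a b := fun i =>
    absolutelyContinuousOnInterval_abs (hP i)
  have hsum : ∑ i, (|P i b| - |P i a|) = ∫ t in a..b, ∑ i, deriv (fun t => |P i t|) t := by
    rw [intervalIntegral.integral_finsetSum fun i _ => (hA i).intervalIntegrable_deriv]
    exact Finset.sum_congr rfl fun i _ => ((hA i).integral_deriv_eq_sub).symm
  have hae : ∀ᵐ t, t ∈ Set.Icc a b → ∑ i, deriv (fun t => |P i t|) t ≤ 0 := by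
    have h1 : ∀ᵐ t, ∀ i, t ∈ Set.uIcc a b → ∀ c ∈ Set.uIcc a b,
        HasDerivAt (fun x => ∫ s in c..x, g i s) (g i t) t :=
      ae_all_iff.2 fun i => (hg i).ae_hasDerivAt_integral
    filter_upwards [h1] with t h1 ht
    have ht' : t ∈ Set.uIcc a b := by rwa [Set.uIcc_of_le hab]
    refine le_trans (le_of_eq (Finset.sum_congr rfl fun i _ => ?_)) (hs t ht)
    rw [deriv_abs_comp ((h1 i ht' a (by simp)).const_add (f i a)), hf i t ht]
  have hle : ∫ t in a..b, ∑ i, deriv (fun t => |P i t|) t ≤ 0 := by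
    rw [intervalIntegral.integral_of_le hab]
    refine integral_nonpos_of_ae ?_
    filter_upwards [ae_restrict_of_ae hae, ae_restrict_mem measurableSet_Ioc] with t h1 h2
    exact h1 (Set.Ioc_subset_Icc_self h2)
  rw [← hsum, Finset.sum_sub_distrib] at hle
  have hPb : ∀ i, P i b = f i b := fun i => (hf i b (Set.right_mem_Icc.2 hab)).symm
  simp only [hPa, hPb] at hle
  linarith

theorem mem_simplex_of_sum_abs_le {S : ℕ} {x : Fin S → ℝ} (h1 : ∑ i, x i = 1)
    (h2 : ∑ i, |x i| ≤ 1) : x ∈ simplex S := by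
  refine ⟨fun i => ?_, h1⟩
  have h3 : ∑ i, (|x i| - x i) = 0 :=
    le_antisymm (by rw [Finset.sum_sub_distrib]; linarith)
      (Finset.sum_nonneg fun i _ => sub_nonneg.2 (le_abs_self _))
  have h4 := (Finset.sum_eq_zero_iff_of_nonneg
    (fun i _ => sub_nonneg.2 (le_abs_self (x i)))).1 h3 i (Finset.mem_univ i)
  have := abs_nonneg (x i)
  linarith

/-- Conservative intensity matrices keep the probability simplex invariant; no bound on the
intensities is needed. -/
theorem mem_simplex_of_intensity_flow {S : ℕ} {a b : ℝ} (hab : a ≤ b) {x w : ℝ → Fin S → ℝ}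
    {A : ℝ → Fin S → Fin S → ℝ} (hoff : ∀ s i j, i ≠ j → 0 ≤ A s i j)
    (hrow : ∀ s i, ∑ j, A s i j = 0)
    (hw : ∀ s j, Real.sign (x s j) * w s j = |w s j|)
    (hint : ∀ i, IntervalIntegrable (fun s => ∑ j, w s j * A s j i) volume a b)
    (hx : ∀ t ∈ Set.Icc a b, ∀ i, x t i = x a i + ∫ s in a..t, ∑ j, w s j * A s j i)
    (h0 : x a ∈ simplex S) : x b ∈ simplex S := by
  have hsign : ∀ r : ℝ, |Real.sign r| ≤ 1 := fun r => by
    rcases Real.sign_apply_eq r with h | h | h <;> simp [h]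
  have hdiss : ∀ s, ∑ i, Real.sign (x s i) * ∑ j, w s j * A s j i ≤ 0 := fun s => by
    have h1 : ∀ i j, Real.sign (x s i) * (w s j * A s j i) ≤ |w s j| * A s j i := fun i j => by
      rw [← mul_assoc]
      by_cases hij : j = i
      · subst hij
        rw [hw]
      · refine mul_le_mul_of_nonneg_right ((le_abs_self _).trans ?_) (hoff s j i hij)
        rw [abs_mul]
        exact mul_le_of_le_one_left (abs_nonneg _) (hsign _)
    calc ∑ i, Real.sign (x s i) * ∑ j, w s j * A s j i
        = ∑ j, ∑ i, Real.sign (x s i) * (w s j * A s j i) := by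
          simp only [Finset.mul_sum]
          exact Finset.sum_comm
      _ ≤ ∑ j, ∑ i, |w s j| * A s j i :=
          Finset.sum_le_sum fun j _ => Finset.sum_le_sum fun i _ => h1 i j
      _ = 0 := by simp [← Finset.mul_sum, hrow]
  have habs : ∑ i, |x b i| ≤ ∑ i, |x a i| :=
    sum_abs_le_of_sign_mul_nonpos (f := fun i t => x t i) hab hint (fun i t ht => hx t ht i)
      fun t _ => hdiss t
  have hsum : ∑ i, x b i = 1 := by
    have hz : ∀ s, ∑ i, ∑ j, w s j * A s j i = 0 := fun s => by
      rw [Finset.sum_comm]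
      simp [← Finset.mul_sum, hrow]
    rw [Finset.sum_congr rfl fun i _ => hx b (Set.right_mem_Icc.2 hab) i,
      Finset.sum_add_distrib, h0.2, ← intervalIntegral.integral_finsetSum fun i _ => hint i]
    simp [hz]
  refine mem_simplex_of_sum_abs_le hsum (habs.trans_eq ?_)
  rw [← h0.2]
  exact Finset.sum_congr rfl fun i _ => abs_of_nonneg (h0.1 i)

/-- A Lipschitz retraction of `ℝ^S` onto the probability simplex. -/
noncomputable def simplexRetraction {S : ℕ} (x : Fin S → ℝ) : Fin S → ℝ := fun i =>
  (max (x i) 0 + max (1 - ∑ j, max (x j) 0) 0 / S) / max (∑ j, max (x j) 0) 1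

theorem simplexRetraction_mem {S : ℕ} (hS : 1 ≤ S) (x : Fin S → ℝ) :
    simplexRetraction x ∈ simplex S := by
  have hS' : (S : ℝ) ≠ 0 := by positivity
  constructor
  · intro i
    unfold simplexRetraction
    positivity
  · unfold simplexRetraction
    rw [← Finset.sum_div, Finset.sum_add_distrib, Finset.sum_const, Finset.card_univ,
      Fintype.card_fin, nsmul_eq_mul, mul_div_cancel₀ _ hS', div_eq_one_iff_eq (by positivity)]
    rcases le_total (∑ j, max (x j) 0) 1 with h | h
    · rw [max_eq_left (by linarith), max_eq_right h]
      ring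
    · rw [max_eq_right (by linarith), max_eq_left h]
      ring

theorem simplexRetraction_of_mem {S : ℕ} {x : Fin S → ℝ} (hx : x ∈ simplex S) :
    simplexRetraction x = x := by
  have h : ∀ j, max (x j) 0 = x j := fun j => max_eq_left (hx.1 j)
  ext i
  simp [simplexRetraction, h, hx.2]

theorem simplexRetraction_lipschitz {S : ℕ} (x y : Fin S → ℝ) :
    ‖simplexRetraction x - simplexRetraction y‖ ≤ (1 + 2 * S) * ‖x - y‖ := by
  have hmax : ∀ p q c : ℝ, |max p c - max q c| ≤ |p - q| :=
    abs_max_sub_max_le_abs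
  rw [pi_norm_le_iff_of_nonneg (by positivity)]
  intro i
  set d := ‖x - y‖
  have hd : ∀ j, |x j - y j| ≤ d := fun j => norm_le_pi_norm (x - y) j
  set p := ∑ j, max (x j) 0 with hp
  set q := ∑ j, max (y j) 0 with hq
  have hpq : |p - q| ≤ S * d := by
    rw [hp, hq, ← Finset.sum_sub_distrib]
    refine (Finset.abs_sum_le_sum_abs _ _).trans ?_
    refine (Finset.sum_le_sum fun j _ => (hmax _ _ _).trans (hd j)).trans ?_
    simp
  have hS : (1 : ℝ) ≤ S := by
    have := i.pos
    exact_mod_cast this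
  have hpart : |max (1 - p) 0 / S - max (1 - q) 0 / S| ≤ d := by
    rw [← sub_div, abs_div, Nat.abs_cast, div_le_iff₀ (by positivity), mul_comm]
    refine (hmax _ _ _).trans ?_
    rwa [sub_sub_sub_cancel_left, abs_sub_comm]
  have hy0 : ∀ j, 0 ≤ max (y j) 0 := fun j => le_max_right _ _
  have hnum : max (y i) 0 + max (1 - q) 0 / S ≤ max q 1 := by
    have h1 : max (y i) 0 ≤ q := Finset.single_le_sum (fun j _ => hy0 j) (Finset.mem_univ i)
    have h2 : max (1 - q) 0 / S ≤ max (1 - q) 0 := div_le_self (le_max_right _ _) hS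
    rcases le_total q 1 with h | h
    · rw [max_eq_left (by linarith : (0 : ℝ) ≤ 1 - q)] at h2 ⊢
      rw [max_eq_right h]
      linarith
    · rw [max_eq_right (by linarith : 1 - q ≤ 0)] at h2 ⊢
      rw [max_eq_left h]
      linarith
  have hnum0 : 0 ≤ max (y i) 0 + max (1 - q) 0 / S := by positivity
  have hden : |max p 1 - max q 1| ≤ S * d := (hmax _ _ _).trans hpq
  have hdiff : |(max (x i) 0 + max (1 - p) 0 / S) - (max (y i) 0 + max (1 - q) 0 / S)| ≤
      (1 + S) * d := by
    have h1 := (hmax (x i) (y i) 0).trans (hd i)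
    have hd0 : 0 ≤ d := norm_nonneg _
    rw [abs_le] at h1 hpart ⊢
    constructor <;> nlinarith
  change |(max (x i) 0 + max (1 - p) 0 / S) / max p 1 -
    (max (y i) 0 + max (1 - q) 0 / S) / max q 1| ≤ _
  generalize max (x i) 0 + max (1 - p) 0 / S = N at *
  generalize max (y i) 0 + max (1 - q) 0 / S = M at *
  have hP : 1 ≤ max p 1 := le_max_right _ _
  have hQ : 1 ≤ max q 1 := le_max_right _ _
  generalize max p 1 = P at *
  generalize max q 1 = Q at *
  have key : N / P - M / Q = (N - M) / P - (M / Q) * ((P - Q) / P) := by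
    field_simp
    ring
  have hMQ : |M / Q| ≤ 1 := by
    rw [abs_of_nonneg (by positivity)]
    exact div_le_one_of_le₀ hnum (by positivity)
  have hdivP : ∀ r : ℝ, |r / P| ≤ |r| := fun r => by
    rw [abs_div, abs_of_nonneg (by positivity : 0 ≤ P)]
    exact div_le_self (abs_nonneg _) hP
  calc |N / P - M / Q| ≤ |(N - M) / P| + |(M / Q) * ((P - Q) / P)| := by
        rw [key]
        exact abs_sub _ _
    _ ≤ (1 + S) * d + 1 * (S * d) := by
        rw [abs_mul (M / Q)]
        gcongr
        · exact (hdivP _).trans hdiff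
        · exact (hdivP _).trans hden
    _ = _ := by ring

theorem continuous_simplexRetraction {S : ℕ} :
    Continuous (simplexRetraction : (Fin S → ℝ) → Fin S → ℝ) :=
  (LipschitzWith.of_dist_le_mul (K := 1 + 2 * S) fun x y => by
    simpa [dist_eq_norm] using simplexRetraction_lipschitz x y).continuous

/-- Truncation of a real number to `[-1, 1]`. -/
noncomputable def clip (r : ℝ) : ℝ := max (min r 1) (-1)

theorem abs_clip_le (r : ℝ) : |clip r| ≤ 1 :=
  abs_le.2 ⟨le_max_right _ _, max_le (min_le_right _ _) (by norm_num)⟩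

theorem abs_clip_sub_clip_le (r s : ℝ) : |clip r - clip s| ≤ |r - s| :=
  (abs_max_sub_max_le_abs _ _ _).trans (by simpa using abs_min_sub_min_le_max r 1 s 1)

theorem clip_of_abs_le {r : ℝ} (h : |r| ≤ 1) : clip r = r := by
  rw [abs_le] at h
  rw [clip, min_eq_left h.2, max_eq_left h.1]

theorem sign_mul_clip (r : ℝ) : Real.sign r * clip r = |clip r| := by
  rcases lt_trichotomy r 0 with h | h | h
  · have : clip r ≤ 0 := max_le ((min_le_left _ _).trans h.le) (by norm_num)
    rw [Real.sign_of_neg h, abs_of_nonpos this, neg_one_mul]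
  · simp [h, clip]
  · have : 0 ≤ clip r := le_max_of_le_left (le_min h.le zero_le_one)
    rw [Real.sign_of_pos h, abs_of_nonneg this, one_mul]

@[fun_prop]
theorem continuous_clip : Continuous clip := by
  unfold clip
  fun_prop

/-- Well-posedness on the simplex of the nonlinear Kolmogorov forward equation. The Lipschitz and
boundedness assumptions on the intensities are only needed on the simplex, while uniqueness holds
among all `ℝ^S`-valued solutions. -/
theorem exists_unique_intensity_flow {S : ℕ} (hS : 1 ≤ S) {a b : ℝ} (hab : a ≤ b)
    {R : ℝ → (Fin S → ℝ) → Fin S → Fin S → ℝ} {C L : ℝ}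
    (hmeas : Measurable fun p : ℝ × (Fin S → ℝ) => R (Set.projIcc a b hab p.1) p.2)
    (hoff : ∀ s m i j, i ≠ j → 0 ≤ R s m i j) (hrow : ∀ s m i, ∑ j, R s m i j = 0)
    (hbdd : ∀ s ∈ Set.Icc a b, ∀ m ∈ simplex S, ∀ i, ∑ j, |R s m i j| ≤ C) (hL : 0 ≤ L)
    (hlip : ∀ s ∈ Set.Icc a b, ∀ m₁ ∈ simplex S, ∀ m₂ ∈ simplex S, ∀ i,
      ∑ j, |R s m₁ i j - R s m₂ i j| ≤ L * ‖m₁ - m₂‖)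
    {m : Fin S → ℝ} (hm : m ∈ simplex S) :
    ∃ x : ℝ → Fin S → ℝ, x a = m ∧
      (∀ t ∈ Set.Icc a b, ∀ i,
        IntervalIntegrable (fun s => ∑ j, x s j * R s (x s) j i) volume a t ∧
        x t i = x a i + ∫ s in a..t, ∑ j, x s j * R s (x s) j i) ∧
      (∀ t ∈ Set.Icc a b, x t ∈ simplex S) ∧
      (∀ t₁ ∈ Set.Icc a b, ∀ t₂ ∈ Set.Icc a b, ‖x t₁ - x t₂‖ ≤ C * |t₁ - t₂|) ∧
      ∀ y : ℝ → Fin S → ℝ, y a = m →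
        (∀ t ∈ Set.Icc a b, ∀ i,
          IntervalIntegrable (fun s => ∑ j, y s j * R s (y s) j i) volume a t ∧
          y t i = y a i + ∫ s in a..t, ∑ j, y s j * R s (y s) j i) →
        ∀ t ∈ Set.Icc a b, y t = x t := by
  have hπ := fun x : Fin S → ℝ => simplexRetraction_mem hS x
  have hC : 0 ≤ C := (Finset.sum_nonneg fun j _ => abs_nonneg _).trans
    (hbdd a (Set.left_mem_Icc.2 hab) m hm ⟨0, hS⟩)
  have hentry : ∀ s ∈ Set.Icc a b, ∀ m ∈ simplex S, ∀ i j, |R s m i j| ≤ C :=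
    fun s hs m hm i j => (Finset.single_le_sum (f := fun j => |R s m i j|)
      (fun j _ => abs_nonneg _) (Finset.mem_univ j)).trans (hbdd s hs m hm i)
  have hentry' : ∀ s ∈ Set.Icc a b, ∀ m₁ ∈ simplex S, ∀ m₂ ∈ simplex S, ∀ i j,
      |R s m₁ i j - R s m₂ i j| ≤ L * ‖m₁ - m₂‖ :=
    fun s hs m₁ h₁ m₂ h₂ i j => (Finset.single_le_sum (f := fun j => |R s m₁ i j - R s m₂ i j|)
      (fun j _ => abs_nonneg _) (Finset.mem_univ j)).trans (hlip s hs m₁ h₁ m₂ h₂ i)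
  -- the globally Lipschitz modification of the right-hand side
  let G : ℝ → (Fin S → ℝ) → Fin S → ℝ := fun s x i =>
    ∑ j, clip (x j) * R (Set.projIcc a b hab s) (simplexRetraction x) j i
  have hGmeas : Measurable (Function.uncurry G) := by
    refine measurable_pi_lambda _ fun i => ?_
    change Measurable fun p : ℝ × (Fin S → ℝ) =>
      ∑ j, clip (p.2 j) * R (Set.projIcc a b hab p.1) (simplexRetraction p.2) j i
    refine Finset.measurable_sum _ fun j _ => Measurable.mul ?_ ?_
    · exact continuous_clip.measurable.comp ((measurable_pi_apply j).comp measurable_snd)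
    · have h1 : Measurable fun p : ℝ × (Fin S → ℝ) => (p.1, simplexRetraction p.2) :=
        measurable_fst.prodMk (continuous_simplexRetraction.measurable.comp measurable_snd)
      exact (measurable_pi_apply i).comp ((measurable_pi_apply j).comp (hmeas.comp h1))
  have hGbdd : ∀ s x, ‖G s x‖ ≤ S * C := fun s x => by
    rw [pi_norm_le_iff_of_nonneg (by positivity)]
    intro i
    refine (norm_sum_le _ _).trans ?_
    refine (Finset.sum_le_sum (g := fun _ => C) fun j _ => ?_).trans_eq (by simp)
    rw [norm_mul]
    have h1 := hentry _ (Set.projIcc a b hab s).2 _ (hπ x) j i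
    exact (mul_le_mul (abs_clip_le _) h1 (abs_nonneg _) zero_le_one).trans_eq (one_mul C)
  have hGlip : ∀ s x y, ‖G s x - G s y‖ ≤ (S * (C + L * (1 + 2 * S))) * ‖x - y‖ :=
    fun s x y => by
    rw [pi_norm_le_iff_of_nonneg (by positivity)]
    intro i
    have hs := (Set.projIcc a b hab s).2
    set s' := ((Set.projIcc a b hab s : Set.Icc a b) : ℝ)
    have hterm : ∀ j, |clip (x j) * R s' (simplexRetraction x) j i -
        clip (y j) * R s' (simplexRetraction y) j i| ≤ (C + L * (1 + 2 * S)) * ‖x - y‖ :=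
      fun j => by
      have e : clip (x j) * R s' (simplexRetraction x) j i -
          clip (y j) * R s' (simplexRetraction y) j i =
          (clip (x j) - clip (y j)) * R s' (simplexRetraction x) j i +
          clip (y j) * (R s' (simplexRetraction x) j i - R s' (simplexRetraction y) j i) := by
        ring
      rw [e]
      refine (abs_add_le _ _).trans ?_
      rw [abs_mul, abs_mul, add_mul]
      refine add_le_add ?_ ?_
      · rw [mul_comm]
        refine mul_le_mul (hentry _ hs _ (hπ x) j i) ?_ (abs_nonneg _) hC
        exact (abs_clip_sub_clip_le _ _).trans (norm_le_pi_norm (x - y) j)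
      · refine (mul_le_of_le_one_left (abs_nonneg _) (abs_clip_le _)).trans ?_
        refine (hentry' _ hs _ (hπ x) _ (hπ y) j i).trans ?_
        rw [mul_assoc]
        exact mul_le_mul_of_nonneg_left (simplexRetraction_lipschitz x y) hL
    rw [Pi.sub_apply, Real.norm_eq_abs]
    change |∑ j, _ - ∑ j, _| ≤ _
    rw [← Finset.sum_sub_distrib]
    refine (Finset.abs_sum_le_sum_abs _ _).trans ?_
    refine (Finset.sum_le_sum fun j _ => hterm j).trans_eq ?_
    simp [mul_assoc]
  have hGeq : ∀ s ∈ Set.Icc a b, ∀ x ∈ simplex S, ∀ i, G s x i = ∑ j, x j * R s x j i := by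
    intro s hs x hx i
    have h1 : ∀ j, |x j| ≤ 1 := fun j => by
      rw [abs_of_nonneg (hx.1 j), ← hx.2]
      exact Finset.single_le_sum (fun j _ => hx.1 j) (Finset.mem_univ j)
    simp only [G, Set.projIcc_of_mem hab hs, simplexRetraction_of_mem hx, clip_of_abs_le (h1 _)]
  obtain ⟨x, hxc, hx, huniq⟩ := exists_unique_caratheodory hGmeas hGbdd (by positivity) hGlip hab m
  have hGint : ∀ c d, IntervalIntegrable (fun s => G s (x s)) volume c d := fun c d =>
    intervalIntegrable_of_measurable_of_norm_le
      (hGmeas.comp (measurable_id.prodMk hxc.measurable)) (fun s => hGbdd _ _) c d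
  have heval : ∀ f : ℝ → Fin S → ℝ, ∀ t, IntervalIntegrable f volume a t → ∀ i,
      (∫ s in a..t, f s) i = ∫ s in a..t, f s i := fun f t hf i =>
    ((ContinuousLinearMap.proj (R := ℝ) (φ := fun _ : Fin S => ℝ) i).intervalIntegral_comp_comm
      hf).symm
  have hproj : ∀ f : ℝ → Fin S → ℝ, ∀ c d, IntervalIntegrable f volume c d → ∀ i,
      IntervalIntegrable (fun s => f s i) volume c d := fun f c d hf i =>
    ⟨hf.1.eval i, hf.2.eval i⟩
  have hxa : x a = m := by simpa using hx a (Set.left_mem_Icc.2 hab)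
  have hxi : ∀ t ∈ Set.Icc a b, ∀ i, x t i = x a i + ∫ s in a..t, G s (x s) i :=
    fun t ht i => by
      rw [hx t ht, Pi.add_apply, heval _ _ (hGint a t), hxa]
  have hxs : ∀ t ∈ Set.Icc a b, x t ∈ simplex S := fun t ht =>
    mem_simplex_of_intensity_flow ht.1 (w := fun s j => clip (x s j))
      (A := fun s => R (Set.projIcc a b hab s) (simplexRetraction (x s)))
      (fun s => hoff _ _) (fun s => hrow _ _) (fun s j => sign_mul_clip _)
      (hproj _ a t (hGint a t)) (fun r hr i => hxi r ⟨hr.1, hr.2.trans ht.2⟩ i)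
      (hxa ▸ hm)
  have hcongr : ∀ y : ℝ → Fin S → ℝ, (∀ t ∈ Set.Icc a b, y t ∈ simplex S) →
      ∀ t ∈ Set.Icc a b, ∀ i, Set.EqOn (fun s => G s (y s) i)
        (fun s => ∑ j, y s j * R s (y s) j i) (Set.uIcc a t) := fun y hy t ht i s hs => by
    rw [Set.uIcc_of_le ht.1] at hs
    have hs' : s ∈ Set.Icc a b := ⟨hs.1, hs.2.trans ht.2⟩
    exact hGeq s hs' _ (hy s hs') i
  refine ⟨x, hxa, fun t ht i => ⟨?_, ?_⟩, hxs, fun t₁ h₁ t₂ h₂ => ?_, fun y hya hy => ?_⟩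
  · exact (hproj _ a t (hGint a t) i).congr
      fun s hs => hcongr x hxs t ht i (Set.uIoc_subset_uIcc hs)
  · rw [hxi t ht i, intervalIntegral.integral_congr (hcongr x hxs t ht i)]
  · rw [pi_norm_le_iff_of_nonneg (by positivity)]
    intro i
    have e : (x t₁ - x t₂) i = ∫ s in t₂..t₁, G s (x s) i := by
      rw [Pi.sub_apply, hxi t₁ h₁ i, hxi t₂ h₂ i, add_sub_add_left_eq_sub,
        intervalIntegral.integral_interval_sub_left (hproj _ _ _ (hGint _ _) i)
          (hproj _ _ _ (hGint _ _) i)]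
    rw [e]
    refine intervalIntegral.norm_integral_le_of_norm_le_const fun s hs => ?_
    have hs' : s ∈ Set.Icc a b :=
      Set.uIcc_subset_Icc h₂ h₁ (Set.uIoc_subset_uIcc hs)
    rw [hGeq s hs' _ (hxs s hs') i]
    refine (norm_sum_le _ _).trans ?_
    calc ∑ j, ‖x s j * R s (x s) j i‖ ≤ ∑ j, x s j * C := Finset.sum_le_sum fun j _ => by
          rw [norm_mul, Real.norm_of_nonneg ((hxs s hs').1 j)]
          exact mul_le_mul_of_nonneg_left (hentry s hs' _ (hxs s hs') j i) ((hxs s hs').1 j)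
      _ = C := by rw [← Finset.sum_mul, (hxs s hs').2, one_mul]
  · have hb := Set.right_mem_Icc.2 hab
    have hys : ∀ t ∈ Set.Icc a b, y t ∈ simplex S := fun t ht =>
      mem_simplex_of_intensity_flow ht.1 (w := y) (A := fun s => R s (y s))
        (fun s => hoff _ _) (fun s => hrow _ _)
        (fun s j => by
          rcases lt_trichotomy (y s j) 0 with h | h | h
          · rw [Real.sign_of_neg h, abs_of_neg h, neg_one_mul]
          · simp [h]
          · rw [Real.sign_of_pos h, abs_of_pos h, one_mul])
        (fun i => (hy t ht i).1) (fun r hr i => (hy r ⟨hr.1, hr.2.trans ht.2⟩ i).2)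
        (hya ▸ hm)
    have hyG : ∀ t ∈ Set.Icc a b, IntervalIntegrable (fun s => G s (y s)) volume a t :=
      fun t ht => by
      have h1 : ∀ i, IntervalIntegrable (fun s => G s (y s) i) volume a t := fun i =>
        (hy t ht i).1.congr fun s hs => (hcongr y hys t ht i (Set.uIoc_subset_uIcc hs)).symm
      exact ⟨Integrable.of_eval fun i => (h1 i).1, Integrable.of_eval fun i => (h1 i).2⟩
    refine huniq y ?_ fun t ht => ?_
    · refine continuousOn_pi.2 fun i => ?_
      have h1 := (intervalIntegral.continuousOn_primitive_interval' (hy b hb i).1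
        Set.left_mem_uIcc).const_add (y a i)
      rw [Set.uIcc_of_le hab] at h1
      exact h1.congr fun t ht => (hy t ht i).2
    · ext i
      rw [Pi.add_apply, heval _ _ (hyG t ht), (hy t ht i).2, hya,
        intervalIntegral.integral_congr (hcongr y hys t ht i)]

theorem card_filter_fin_val_lt {n k : ℕ} (hk : k ≤ n) :
    (Finset.univ.filter fun i : Fin n => (i : ℕ) < k).card = k := by
  rw [Fin.card_filter_val_lt, min_eq_right hk]

/-- The number of initial coordinates in the definition of `𝕌` is `Z(u)`. -/
theorem memU_iff {n : ℕ} {T : ℝ} {u : Fin n → ℝ} :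
    memU n T u ↔ Zu u ≤ n ∧ (∀ i : Fin n, (i : ℕ) < Zu u → u i ∈ Set.Icc (0 : ℝ) T) ∧
      (∀ i j : Fin n, (j : ℕ) < Zu u → i ≤ j → u i ≤ u j) ∧
      (∀ i : Fin n, Zu u ≤ (i : ℕ) → u i = -1) := by
  refine ⟨?_, fun h => ⟨_, h⟩⟩
  rintro ⟨k, hk, h1, h2, h3⟩
  have hZ : Zu u = k := by
    rw [Zu, ← card_filter_fin_val_lt hk]
    congr 1
    ext i
    simp only [Finset.mem_filter, Finset.mem_univ, true_and]
    refine ⟨fun h => ?_, fun h he => ?_⟩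
    · by_contra hc
      exact h (h3 i (not_lt.1 hc))
    · have := (h1 i h).1
      linarith
  rw [hZ]
  exact ⟨hk, h1, h2, h3⟩

theorem memU.lastTime_eq {n : ℕ} {T : ℝ} {u : Fin n → ℝ} (hu : memU n T u) (hZ : 1 ≤ Zu u) :
    ∃ h : Zu u - 1 < n, lastTime u = u ⟨Zu u - 1, h⟩ := by
  have h : Zu u - 1 < n := by have := (memU_iff.1 hu).1; omega
  exact ⟨h, dif_pos h⟩

theorem memU.startTime_mem {n : ℕ} {T : ℝ} (hT : 0 ≤ T) {u : Fin n → ℝ} (hu : memU n T u) :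
    startTime u ∈ Set.Icc 0 T := by
  unfold startTime
  split_ifs with h
  · exact ⟨le_rfl, hT⟩
  · obtain ⟨h1, h2⟩ := hu.lastTime_eq (by omega)
    rw [h2]
    exact (memU_iff.1 hu).2.1 _ (by simp only; omega)

theorem memU.le_startTime {n : ℕ} {T : ℝ} (hT : 0 ≤ T) {u : Fin n → ℝ} (hu : memU n T u)
    (i : Fin n) : u i ≤ startTime u := by
  have hs := (hu.startTime_mem hT).1
  obtain ⟨-, -, h2, h3⟩ := memU_iff.1 hu
  by_cases hi : Zu u ≤ (i : ℕ)
  · rw [h3 i hi]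
    linarith
  · rw [startTime, if_neg (by omega)]
    obtain ⟨h, he⟩ := hu.lastTime_eq (by omega)
    rw [he]
    refine h2 _ _ (by simp only; omega) (Fin.le_def.2 ?_)
    simp only
    omega

theorem memTS_iff {n : ℕ} {T : ℝ} (hT : 0 ≤ T) {t : ℝ} {u : Fin n → ℝ} :
    memTS n T t u ↔ memU n T u ∧ t ∈ Set.Icc (startTime u) T := by
  refine ⟨fun ⟨hu, ht, h⟩ => ⟨hu, ?_, ht.2⟩, fun ⟨hu, ht⟩ =>
    ⟨hu, ⟨(hu.startTime_mem hT).1.trans ht.1, ht.2⟩, fun i => (hu.le_startTime hT i).trans ht.1⟩⟩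
  unfold startTime
  split_ifs with h0
  · exact ht.1
  · obtain ⟨h1, h2⟩ := hu.lastTime_eq (by omega)
    exact h2 ▸ h _

theorem eq_neg_one_of_Zu_eq_zero {n : ℕ} {u : Fin n → ℝ} (h : Zu u = 0) : u = fun _ => -1 := by
  ext i
  by_contra hi
  exact Finset.notMem_empty i (Finset.card_eq_zero.1 h ▸ by simpa using hi)

theorem memU.Zu_pop {n : ℕ} {T : ℝ} {u : Fin n → ℝ} (hu : memU n T u) (hZ : 1 ≤ Zu u) :
    Zu (pop u) = Zu u - 1 := by
  obtain ⟨hn, h1, -, h3⟩ := memU_iff.1 hu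
  rw [Zu, ← card_filter_fin_val_lt (n := n) (k := Zu u - 1) (by omega)]
  congr 1
  ext i
  rw [Finset.mem_filter, Finset.mem_filter]
  simp only [Finset.mem_univ, true_and, pop]
  split_ifs with h
  · simp only [ne_eq, not_true_eq_false, false_iff]
    omega
  · refine ⟨fun h' => ?_, fun h' he => ?_⟩
    · by_contra hc
      exact h' (h3 i (by omega))
    · have := (h1 i (by omega)).1
      linarith

theorem memU.pop_mem {n : ℕ} {T : ℝ} {u : Fin n → ℝ} (hu : memU n T u) (hZ : 1 ≤ Zu u) :
    memU n T (pop u) := by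
  obtain ⟨hn, h1, h2, h3⟩ := memU_iff.1 hu
  refine ⟨Zu u - 1, by omega, fun i hi => ?_, fun i j hj hij => ?_, fun i hi => ?_⟩
  · rw [pop, if_neg (by omega)]
    exact h1 i (by omega)
  · have hij' := Fin.le_def.1 hij
    rw [pop, pop, if_neg (by omega), if_neg (by omega)]
    exact h2 i j (by omega) hij
  · unfold pop
    split_ifs with h
    · rfl
    · exact h3 i (by omega)

theorem memU.startTime_pop_le {n : ℕ} {T : ℝ} (hT : 0 ≤ T) {u : Fin n → ℝ} (hu : memU n T u)
    (hZ : 1 ≤ Zu u) : startTime (pop u) ≤ lastTime u := by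
  obtain ⟨h1, h2⟩ := hu.lastTime_eq hZ
  have h0 : startTime u = lastTime u := by rw [startTime, if_neg (by omega)]
  rw [← h0]
  conv_lhs => rw [startTime]
  split_ifs with h
  · exact (hu.startTime_mem hT).1
  · obtain ⟨h3, h4⟩ := (hu.pop_mem hZ).lastTime_eq (by omega)
    rw [h4, pop, if_neg]
    · exact hu.le_startTime hT _
    · have := hu.Zu_pop hZ
      simp only
      omega

/-- The image of a distribution under a relocation map. -/
noncomputable def relocate {S : ℕ} (σ : Fin S → Fin S) (m : Fin S → ℝ) : Fin S → ℝ :=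
  fun j => ∑ i, if σ i = j then m i else 0

theorem relocate_mem_simplex {S : ℕ} (σ : Fin S → Fin S) {m : Fin S → ℝ} (hm : m ∈ simplex S) :
    relocate σ m ∈ simplex S := by
  refine ⟨fun j => Finset.sum_nonneg fun i _ => ?_, ?_⟩
  · split_ifs
    exacts [hm.1 i, le_rfl]
  · unfold relocate
    rw [Finset.sum_comm]
    simpa using hm.2

theorem AbsContOn.continuousOn {E : Type*} [NormedAddCommGroup E] {f : ℝ → E} {a b : ℝ}
    (hf : AbsContOn f a b) : ContinuousOn f (Set.Icc a b) := by
  rw [Metric.continuousOn_iff]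
  intro t ht ε hε
  obtain ⟨δ, hδ, h⟩ := hf ε hε
  refine ⟨δ, hδ, fun s hs hst => ?_⟩
  rw [Real.dist_eq] at hst
  have key : ∀ c d, c ∈ Set.Icc a b → d ∈ Set.Icc a b → c ≤ d → d - c < δ →
      ‖f d - f c‖ < ε := fun c d hc hd hcd hlt => by
    simpa using h 1 (fun _ => c) (fun _ => d) (fun _ => ⟨hc.1, hcd, hd.2⟩)
      (fun k l hkl => absurd (Subsingleton.elim k l) hkl) (by simpa using hlt)
  rcases le_total s t with hle | hle
  · rw [dist_comm, dist_eq_norm]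
    exact key s t hs ht hle (by rw [abs_lt] at hst; linarith)
  · rw [dist_eq_norm]
    exact key t s ht hs hle (by rw [abs_lt] at hst; linarith)

theorem absContOn_of_lipschitz {E : Type*} [NormedAddCommGroup E] {f : ℝ → E} {a b C : ℝ}
    (h : ∀ s ∈ Set.Icc a b, ∀ t ∈ Set.Icc a b, ‖f s - f t‖ ≤ C * |s - t|) : AbsContOn f a b := by
  intro ε hε
  refine ⟨ε / (|C| + 1), by positivity, fun N c d hcd _ hsum => ?_⟩
  have hterm : ∀ k, ‖f (d k) - f (c k)‖ ≤ (|C| + 1) * (d k - c k) := fun k => by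
    obtain ⟨h1, h2, h3⟩ := hcd k
    refine (h _ ⟨h1.trans h2, h3⟩ _ ⟨h1, h2.trans h3⟩).trans ?_
    rw [abs_of_nonneg (sub_nonneg.2 h2)]
    exact mul_le_mul_of_nonneg_right ((le_abs_self C).trans (by linarith)) (sub_nonneg.2 h2)
  calc ∑ k, ‖f (d k) - f (c k)‖ ≤ ∑ k, (|C| + 1) * (d k - c k) :=
        Finset.sum_le_sum fun k _ => hterm k
    _ = (|C| + 1) * ∑ k, (d k - c k) := by rw [Finset.mul_sum]
    _ < (|C| + 1) * (ε / (|C| + 1)) := by gcongr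
    _ = ε := by field_simp

/-- Gluing of the flows between consecutive shocks, by recursion on the number of shocks: `sol u m`
is the flow started from `m` at the last shock of `u`. -/
noncomputable def glueFlows {S n : ℕ} (D : Model S n)
    (sol : (Fin n → ℝ) → (Fin S → ℝ) → ℝ → Fin S → ℝ) : ℕ → ℝ → (Fin n → ℝ) → Fin S → ℝ
  | 0, t, u => sol u D.m0 t
  | k + 1, t, u =>
    sol u (relocate (D.J (lastTime u)) (glueFlows D sol k (lastTime u) (pop u))) t

theorem exists_unique_flow_between_shocks {S n : ℕ} {T : ℝ} {D : Model S n}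
    {Lpsi LQ LPsi Llam Psimax psimax Qmax lammax : ℝ} {Jmax : ℕ}
    (H : Hyps S n T D Lpsi LQ LPsi Llam Psimax psimax Qmax lammax Jmax)
    {v : ℝ → (Fin n → ℝ) → Fin S → ℝ} (hv : Regular S n T v)
    {u : Fin n → ℝ} (hu : memU n T u) {m : Fin S → ℝ} (hm : m ∈ simplex S) :
    ∃ x : ℝ → Fin S → ℝ, x (startTime u) = m ∧
      (∀ t ∈ Set.Icc (startTime u) T, ∀ i,
        IntervalIntegrable (fun s => ∑ j, x s j * D.Q s u (x s) (v s u) j i) volume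
          (startTime u) t ∧
        x t i = x (startTime u) i +
          ∫ s in (startTime u)..t, ∑ j, x s j * D.Q s u (x s) (v s u) j i) ∧
      (∀ t ∈ Set.Icc (startTime u) T, x t ∈ simplex S) ∧
      (∀ t₁ ∈ Set.Icc (startTime u) T, ∀ t₂ ∈ Set.Icc (startTime u) T,
        ‖x t₁ - x t₂‖ ≤ Qmax * |t₁ - t₂|) ∧
      ∀ y : ℝ → Fin S → ℝ, y (startTime u) = m →
        (∀ t ∈ Set.Icc (startTime u) T, ∀ i,
          IntervalIntegrable (fun s => ∑ j, y s j * D.Q s u (y s) (v s u) j i) volume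
            (startTime u) t ∧
          y t i = y (startTime u) i +
            ∫ s in (startTime u)..t, ∑ j, y s j * D.Q s u (y s) (v s u) j i) →
        ∀ t ∈ Set.Icc (startTime u) T, y t = x t := by
  have hT := H.hT.le
  have hab := (hu.startTime_mem hT).2
  have hTS : ∀ s ∈ Set.Icc (startTime u) T, memTS n T s u := fun s hs => (memTS_iff hT).2 ⟨hu, hs⟩
  set w : ℝ → Fin S → ℝ := fun s => v (Set.projIcc (startTime u) T hab s) u
  have hw : Continuous w :=
    (continuousOn_iff_continuous_domRestrict.1 (hv u hu).continuousOn).comp continuous_projIcc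
  refine exists_unique_intensity_flow H.hS hab (R := fun s m => D.Q s u m (v s u)) (C := Qmax)
    (L := LQ) ?_ (fun s m => H.Q_offdiag s u m _) (fun s m => H.Q_rowsum s u m _)
    (fun s hs m hm => H.Q_bdd s u m _ (hTS s hs) hm) H.hLQ.le (fun s hs m₁ h₁ m₂ h₂ i => ?_) hm
  · have hproj : Continuous fun s => (Set.projIcc (startTime u) T hab s : ℝ) :=
      continuous_subtype_val.comp continuous_projIcc
    exact H.Q_meas.comp ((hproj.measurable.comp measurable_fst).prodMk
      (measurable_const.prodMk (measurable_snd.prodMk (hw.measurable.comp measurable_fst))))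
  · simpa using H.Q_lip s u (hTS s hs) m₁ h₁ m₂ h₂ (v s u) (v s u) i

/-- **Lemma B.3** (existence and uniqueness for the forward system).
Under the Lipschitz assumptions on the model data, for every `v ∈ V` there exists a unique
regular solution `μ` of (E2), (E4) and (E5); moreover the solution takes values in the
probability simplex on `TS` and is `Qmax`-Lipschitz in time, i.e. `μ ∈ M`. -/
theorem forward_exists_unique (S n : ℕ) (T : ℝ) (D : Model S n)
    (Lpsi LQ LPsi Llam Psimax psimax Qmax lammax : ℝ) (Jmax : ℕ)
    (H : Hyps S n T D Lpsi LQ LPsi Llam Psimax psimax Qmax lammax Jmax)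
    (v : ℝ → (Fin n → ℝ) → Fin S → ℝ)
    (hv : MemV S n T (vmaxC n T Psimax psimax Qmax lammax) v) :
    ∃ μ : ℝ → (Fin n → ℝ) → Fin S → ℝ,
      Regular S n T μ ∧ SolForward S n T D v μ ∧ MemM S n T Qmax μ ∧
      ∀ μ' : ℝ → (Fin n → ℝ) → Fin S → ℝ,
        Regular S n T μ' → SolForward S n T D v μ' →
        ∀ t u, memTS n T t u → μ' t u = μ t u := by
  have hT := H.hT.le
  choose! sol hinit hode hsimp hlip huniq using
    fun (u : Fin n → ℝ) (m : Fin S → ℝ) (hu : memU n T u) (hm : m ∈ simplex S) =>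
      exists_unique_flow_between_shocks H hv.1 hu hm
  set μ : ℝ → (Fin n → ℝ) → Fin S → ℝ := fun t u => glueFlows D sol (Zu u) t u with hμ
  have hμzero : ∀ t u, Zu u = 0 → μ t u = sol u D.m0 t := fun t u h => by
    simp only [hμ, h, glueFlows]
  have hμsucc : ∀ t u, memU n T u → 1 ≤ Zu u →
      μ t u = sol u (relocate (D.J (lastTime u)) (μ (lastTime u) (pop u))) t := fun t u hu h => by
    obtain ⟨k, hk⟩ : ∃ k, Zu u = k + 1 := ⟨Zu u - 1, by omega⟩
    have hk' : Zu (pop u) = k := by rw [hu.Zu_pop h, hk, Nat.add_sub_cancel]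
    simp only [hμ, hk, hk', glueFlows]
  have hstart : ∀ u : Fin n → ℝ, 1 ≤ Zu u → startTime u = lastTime u := fun u h => if_neg (by omega)
  have hlast : ∀ u, memU n T u → 1 ≤ Zu u → lastTime u ∈ Set.Icc (startTime (pop u)) T :=
    fun u hu h => ⟨hu.startTime_pop_le hT h, hstart u h ▸ (hu.startTime_mem hT).2⟩
  have hflow : ∀ k u, memU n T u → Zu u = k →
      ∃ m ∈ simplex S, ∀ t, μ t u = sol u m t := by
    intro k
    induction k with
    | zero => exact fun u _ h => ⟨D.m0, H.hm0, fun t => hμzero t u h⟩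
    | succ k ih =>
      intro u hu h
      have h1 : 1 ≤ Zu u := by omega
      obtain ⟨m, hm, he⟩ := ih (pop u) (hu.pop_mem h1) (by rw [hu.Zu_pop h1]; omega)
      refine ⟨_, relocate_mem_simplex _ ?_, fun t => hμsucc t u hu h1⟩
      rw [he]
      exact hsimp _ m (hu.pop_mem h1) hm _ (hlast u hu h1)
  have hmem : ∀ t u, memTS n T t u → μ t u ∈ simplex S := fun t u htu => by
    obtain ⟨hu, ht⟩ := (memTS_iff hT).1 htu
    obtain ⟨m, hm, he⟩ := hflow _ u hu rfl
    rw [he]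
    exact hsimp u m hu hm t ht
  have hLip : ∀ u, memU n T u → ∀ t₁ ∈ Set.Icc (startTime u) T, ∀ t₂ ∈ Set.Icc (startTime u) T,
      ‖μ t₁ u - μ t₂ u‖ ≤ Qmax * |t₁ - t₂| := fun u hu t₁ h₁ t₂ h₂ => by
    obtain ⟨m, hm, he⟩ := hflow _ u hu rfl
    rw [he, he]
    exact hlip u m hu hm t₁ h₁ t₂ h₂
  have hjump : ∀ u, memU n T u → 1 ≤ Zu u →
      μ (lastTime u) u = relocate (D.J (lastTime u)) (μ (lastTime u) (pop u)) := fun u hu h => by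
    rw [hμsucc _ u hu h, ← hstart u h]
    refine hinit u _ hu (relocate_mem_simplex _ (hmem _ _ ?_))
    exact (memTS_iff hT).2 ⟨hu.pop_mem h, hstart u h ▸ hlast u hu h⟩
  have hU0 : memU n T (fun _ => -1) :=
    ⟨0, n.zero_le, fun i hi => absurd hi (Nat.not_lt_zero _),
      fun i j hj => absurd hj (Nat.not_lt_zero _), fun _ _ => rfl⟩
  have hZ0 : Zu (fun _ : Fin n => (-1 : ℝ)) = 0 := by simp [Zu]
  have hs0 : startTime (fun _ : Fin n => (-1 : ℝ)) = 0 := if_pos hZ0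
  have hμ0 : μ 0 (fun _ => -1) = D.m0 := by
    rw [hμzero _ _ hZ0]
    exact hs0 ▸ hinit _ D.m0 hU0 H.hm0
  refine ⟨μ, fun u hu => absContOn_of_lipschitz (hLip u hu),
    ⟨congrFun hμ0, fun u hu h => congrFun (hjump u hu h), fun u hu t htu => ?_⟩,
    ⟨hmem, fun u hu t₁ t₂ h₁ h₂ =>
      hLip u hu t₁ ((memTS_iff hT).1 h₁).2 t₂ ((memTS_iff hT).1 h₂).2⟩, ?_⟩
  · obtain ⟨m, hm, he⟩ := hflow _ u hu rfl
    unfold E2rhs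
    simp only [he]
    exact hode u m hu hm t ((memTS_iff hT).1 htu).2
  · intro μ' _ ⟨h0, hjump', hode'⟩
    have key : ∀ u, memU n T u → μ' (startTime u) u = μ (startTime u) u →
        ∀ t ∈ Set.Icc (startTime u) T, μ' t u = μ t u := fun u hu hst t ht => by
      obtain ⟨m, hm, he⟩ := hflow _ u hu rfl
      rw [he] at hst ⊢
      exact huniq u m hu hm (fun t => μ' t u) (hst.trans (hinit u m hu hm))
        (fun t ht => hode' u hu t ((memTS_iff hT).2 ⟨hu, ht⟩)) t ht
    have main : ∀ k u, memU n T u → Zu u = k →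
        ∀ t ∈ Set.Icc (startTime u) T, μ' t u = μ t u := by
      intro k
      induction k with
      | zero =>
        intro u hu h
        refine key u hu ?_
        rw [eq_neg_one_of_Zu_eq_zero h, hs0, hμ0]
        exact funext h0
      | succ k ih =>
        intro u hu h
        have h1 : 1 ≤ Zu u := by omega
        refine key u hu ?_
        rw [hstart u h1, hjump u hu h1,
          ← ih (pop u) (hu.pop_mem h1) (by rw [hu.Zu_pop h1]; omega) _ (hlast u hu h1)]
        exact funext (hjump' u hu h1)
    exact fun t u htu => main _ u ((memTS_iff hT).1 htu).1 rfl t ((memTS_iff hT).1 htu).2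

end MFGShocks
end

section
/- (Lemma B.5: Lipschitz continuity of the forward solution map.) Let the model data satisfy the Lipschitz assumptions, and let F⃗ : V → M be the map sending v ∈ V to the unique solution of (E2), (E4) and (E5) given v (which exists by Lemma B.3). Then F⃗ is Lipschitz continuous with respect to the supremum norms: for all v, v̄ ∈ V, sup_{(t,u)∈TS} ‖F⃗(v)(t,u) − F⃗(v̄)(t,u)‖ ≤ L_Q̂ · T · ( Σ_{i=0}^{n} ( exp((Qmax + L_Q̂)·T) )^{i+1} · Jmax^i ) · sup_{(t,u)∈TS} ‖v(t,u) − v̄(t,u)‖. -/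
open MeasureTheory
open scoped BigOperators Classical

namespace MFGShocks

/-! ### Calculus lemmas -/

/-- The negative part of a primitive `y` of `h` is a primitive of `1_{y < 0} h`. -/
theorem integral_ite_neg_eq_min_sub_min {h y : ℝ → ℝ} {a b : ℝ}
    (hh : IntervalIntegrable h volume a b) (hy : ∀ t, y t = y a + ∫ s in a..t, h s) :
    IntervalIntegrable (fun s => if y s < 0 then h s else 0) volume a b ∧
      ∫ s in a..b, (if y s < 0 then h s else 0) = min (y b) 0 - min (y a) 0 := by
  have hyac : AbsolutelyContinuousOnInterval y a b := by
    have h1 := hh.absolutelyContinuousOnInterval_intervalIntegral (c := a) (by simp)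
    refine squeeze_zero (fun t => Finset.sum_nonneg fun i _ => by positivity) (fun t => ?_) h1
    refine Finset.sum_le_sum fun i _ => ?_
    rw [hy (t.2 i).1, hy (t.2 i).2, dist_add_left]
  have hmin : AbsolutelyContinuousOnInterval (fun t => min (y t) 0) a b := by
    refine squeeze_zero (fun t => Finset.sum_nonneg fun i _ => by positivity) (fun t => ?_) hyac
    refine Finset.sum_le_sum fun i _ => ?_
    rw [Real.dist_eq, Real.dist_eq]
    simpa using abs_min_sub_min_le_max (y (t.2 i).1) 0 (y (t.2 i).2) 0
  have hderiv : ∀ᵐ x, x ∈ Set.uIcc a b →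
      deriv (fun t => min (y t) 0) x = if y x < 0 then h x else 0 := by
    filter_upwards [hh.ae_hasDerivAt_integral] with x hx hxab
    have hyx : HasDerivAt y (h x) x := by
      have h2 := (hx hxab a (by simp)).const_add (y a)
      rwa [← funext hy] at h2
    split_ifs with hneg
    · refine (hyx.congr_of_eventuallyEq ?_).deriv
      filter_upwards [hyx.continuousAt.eventually (gt_mem_nhds hneg)] with t ht
      exact min_eq_left ht.le
    · refine IsLocalMax.deriv_eq_zero (Filter.Eventually.of_forall fun t => ?_)
      simp only [min_eq_right (not_lt.1 hneg)]
      exact min_le_right _ _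
  have hsub : ∀ᵐ x, x ∈ Set.uIoc a b →
      deriv (fun t => min (y t) 0) x = if y x < 0 then h x else 0 := by
    filter_upwards [hderiv] with x hx hxab
    exact hx (Set.uIoc_subset_uIcc hxab)
  refine ⟨hmin.intervalIntegrable_deriv.congr_ae ?_, ?_⟩
  · exact (ae_restrict_iff' measurableSet_uIoc).2 hsub
  · rw [← intervalIntegral.integral_congr_ae hsub]
    exact hmin.integral_deriv_eq_sub

/-- Grönwall's inequality in integral form. -/
theorem le_exp_mul_of_le_add_integral {f : ℝ → ℝ} {a b K ε : ℝ} (hab : a ≤ b) (hK : 0 ≤ K)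
    (hε : 0 ≤ ε) (hf : ContinuousOn f (Set.Icc a b))
    (hle : ∀ t ∈ Set.Icc a b, f t ≤ f a + ∫ s in a..t, (K * f s + ε)) :
    f b ≤ Real.exp (K * (b - a)) * (f a + ε * (b - a)) := by
  set y : ℝ → ℝ := fun t => f a + ∫ s in a..t, (K * f s + ε) with hydef
  have hg : ContinuousOn (fun s => K * f s + ε) (Set.Icc a b) := by fun_prop
  have hgi : IntervalIntegrable (fun s => K * f s + ε) volume a b :=
    (by rwa [Set.uIcc_of_le hab] : ContinuousOn _ (Set.uIcc a b)).intervalIntegrable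
  have hyc : ContinuousOn y (Set.Icc a b) := by
    have := intervalIntegral.continuousOn_primitive_interval' hgi Set.left_mem_uIcc
    rw [Set.uIcc_of_le hab] at this
    exact continuousOn_const.add this
  set w : ℝ → ℝ := fun t => Real.exp (-(K * (t - a))) * y t - ε * (t - a) with hwdef
  have hwc : ContinuousOn w (Set.Icc a b) := by
    simp only [hwdef]
    fun_prop
  have hw : ∀ t ∈ Set.Ioo a b, HasDerivAt w
      (Real.exp (-(K * (t - a))) * (-K) * y t + Real.exp (-(K * (t - a))) * (K * f t + ε) - ε)
      t := by
    intro t ht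
    have hat : Set.Icc a b ∈ nhds t := Icc_mem_nhds ht.1 ht.2
    have hyd : HasDerivAt y (K * f t + ε) t := by
      refine HasDerivAt.const_add _ ?_
      refine intervalIntegral.integral_hasDerivAt_right
        (hgi.mono_set ?_) ?_ (hg.continuousAt hat)
      · rw [Set.uIcc_of_le hab, Set.uIcc_of_le ht.1.le]
        exact Set.Icc_subset_Icc_right ht.2.le
      · exact (hg.mono Set.Ioo_subset_Icc_self).stronglyMeasurableAtFilter isOpen_Ioo t ht
    have he : HasDerivAt (fun t => Real.exp (-(K * (t - a))))
        (Real.exp (-(K * (t - a))) * (-K)) t := by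
      refine HasDerivAt.exp ?_
      simpa using ((hasDerivAt_id t).sub_const a |>.const_mul K).fun_neg
    have hl : HasDerivAt (fun t => ε * (t - a)) ε t := by
      simpa using ((hasDerivAt_id t).sub_const a).const_mul ε
    exact (he.mul hyd).sub hl
  have hanti : AntitoneOn w (Set.Icc a b) := by
    refine antitoneOn_of_deriv_nonpos (convex_Icc a b) hwc ?_ ?_
    · intro t ht
      rw [interior_Icc] at ht
      exact (hw t ht).differentiableAt.differentiableWithinAt
    · intro t ht
      rw [interior_Icc] at ht
      rw [(hw t ht).deriv]
      have h1 : f t ≤ y t := hle t ⟨ht.1.le, ht.2.le⟩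
      have h2 : Real.exp (-(K * (t - a))) ≤ 1 := by
        rw [Real.exp_le_one_iff]
        nlinarith [mul_nonneg hK (sub_nonneg.2 ht.1.le)]
      have h3 := Real.exp_pos (-(K * (t - a)))
      nlinarith [mul_nonneg h3.le (mul_nonneg hK (sub_nonneg.2 h1)),
        mul_nonneg hε (sub_nonneg.2 h2)]
  have hwab := hanti (Set.left_mem_Icc.2 hab) (Set.right_mem_Icc.2 hab) hab
  have hwa : w a = f a := by simp [hwdef, hydef]
  have hfb : f b ≤ y b := hle b (Set.right_mem_Icc.2 hab)
  rw [hwa] at hwab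
  have hexp : Real.exp (K * (b - a)) * Real.exp (-(K * (b - a))) = 1 := by
    rw [← Real.exp_add]; simp
  have h4 := mul_le_mul_of_nonneg_left hwab (Real.exp_pos (K * (b - a))).le
  have h5 : Real.exp (K * (b - a)) * w b
      = y b - Real.exp (K * (b - a)) * (ε * (b - a)) := by
    simp only [hwdef]
    linear_combination y b * hexp
  rw [mul_add]
  linarith

/-! ### Linear forward equations with intensity matrices -/

/-- An intensity matrix moves mass from the positive to the negative coordinates. -/
theorem sum_ite_neg_vecMul_nonneg {S : ℕ} {A : Fin S → Fin S → ℝ} (x : Fin S → ℝ)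
    (hoff : ∀ i j, i ≠ j → 0 ≤ A i j) (hrow : ∀ i, ∑ j, A i j = 0) :
    0 ≤ ∑ i, (if x i < 0 then ∑ j, x j * A j i else 0) := by
  have hswap : ∑ i, (if x i < 0 then ∑ j, x j * A j i else 0)
      = ∑ j, x j * ∑ i, (if x i < 0 then A j i else 0) := by
    simp only [Finset.mul_sum]
    rw [Finset.sum_comm]
    refine Finset.sum_congr rfl fun i _ => ?_
    split_ifs <;> simp
  rw [hswap]
  refine Finset.sum_nonneg fun j _ => ?_
  by_cases hj : x j < 0
  · have hcompl : 0 ≤ ∑ i, (if x i < 0 then 0 else A j i) := by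
      refine Finset.sum_nonneg fun i _ => ?_
      split_ifs with hi
      · exact le_rfl
      · exact hoff j i fun hji => hi (hji ▸ hj)
    have hsplit : ∑ i, (if x i < 0 then A j i else 0) + ∑ i, (if x i < 0 then 0 else A j i)
        = 0 := by
      rw [← Finset.sum_add_distrib]
      refine Eq.trans ?_ (hrow j)
      refine Finset.sum_congr rfl fun i _ => ?_
      split_ifs <;> simp
    exact mul_nonneg_of_nonpos_of_nonpos hj.le (by linarith)
  · refine mul_nonneg (not_lt.1 hj) (Finset.sum_nonneg fun i _ => ?_)
    split_ifs with hi
    · exact hoff j i fun hji => hj (hji ▸ hi)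
    · exact le_rfl

/-- `m` solves the linear forward equation with coefficient matrix `A` on `[a,b]`, in the
Carathéodory sense. -/
def SolvesOn {S : ℕ} (m : ℝ → Fin S → ℝ) (A : ℝ → Fin S → Fin S → ℝ) (a b : ℝ) : Prop :=
  ∀ t ∈ Set.Icc a b, ∀ i,
    IntervalIntegrable (fun s => ∑ j, m s j * A s j i) volume a t ∧
      m t i = m a i + ∫ s in a..t, ∑ j, m s j * A s j i

theorem SolvesOn.mem_simplex {S : ℕ} {m : ℝ → Fin S → ℝ} {A : ℝ → Fin S → Fin S → ℝ} {a b : ℝ}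
    (hm : SolvesOn m A a b) (hab : a ≤ b) (hoff : ∀ t i j, i ≠ j → 0 ≤ A t i j)
    (hrow : ∀ t i, ∑ j, A t i j = 0) (ha : m a ∈ simplex S) : m b ∈ simplex S := by
  have hb : b ∈ Set.Icc a b := Set.right_mem_Icc.2 hab
  set y : Fin S → ℝ → ℝ := fun i t => m a i + ∫ s in a..t, ∑ j, m s j * A s j i with hy
  have hya : ∀ i, y i a = m a i := fun i => by simp [hy]
  have hyb : ∀ i, y i b = m b i := fun i => ((hm b hb i).2).symm
  have key := fun i => integral_ite_neg_eq_min_sub_min (y := y i) (hm b hb i).1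
    (fun t => by rw [hya])
  constructor
  · have hnonneg : 0 ≤ ∫ s in a..b, ∑ i, (if y i s < 0 then ∑ j, m s j * A s j i else 0) := by
      refine intervalIntegral.integral_nonneg hab fun s hs => ?_
      have hys : ∀ i, y i s = m s i := fun i => ((hm s hs i).2).symm
      simp only [hys]
      exact sum_ite_neg_vecMul_nonneg (m s) (hoff s) (hrow s)
    rw [intervalIntegral.integral_finsetSum fun i _ => (key i).1] at hnonneg
    have heq : ∀ i ∈ Finset.univ, ∫ s in a..b, (if y i s < 0 then ∑ j, m s j * A s j i else 0)
        = min (m b i) 0 := by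
      intro i _
      rw [(key i).2, hya, hyb, min_eq_right (ha.1 i), sub_zero]
    rw [Finset.sum_congr rfl heq] at hnonneg
    intro i
    have hzero := (Finset.sum_eq_zero_iff_of_nonpos fun i _ => min_le_right (m b i) 0).1
      (le_antisymm (Finset.sum_nonpos fun i _ => min_le_right (m b i) 0) hnonneg) i
      (Finset.mem_univ i)
    exact min_eq_right_iff.1 hzero
  · have hsum : ∑ i, m b i = ∑ i, m a i + ∫ s in a..b, ∑ i, ∑ j, m s j * A s j i := by
      rw [intervalIntegral.integral_finsetSum fun i _ => (hm b hb i).1, ← Finset.sum_add_distrib]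
      exact Finset.sum_congr rfl fun i _ => (hm b hb i).2
    have hz : ∀ s, ∑ i, ∑ j, m s j * A s j i = 0 := by
      intro s
      rw [Finset.sum_comm]
      simp [← Finset.mul_sum, hrow]
    rw [hsum, ha.2]
    simp [hz]

/-- Pointwise `ℓ¹`-estimate for the difference of two right-hand sides. -/
theorem sum_abs_vecMul_sub_le {S : ℕ} {A A' : Fin S → Fin S → ℝ} {x x' : Fin S → ℝ} {C L δ : ℝ}
    (hL : 0 ≤ L) (hx' : x' ∈ simplex S) (hA : ∀ i, ∑ j, |A i j| ≤ C)
    (hAA' : ∀ i, ∑ j, |A i j - A' i j| ≤ L * (‖x - x'‖ + δ)) :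
    ∑ i, |∑ j, x j * A j i - ∑ j, x' j * A' j i| ≤ (C + L) * ∑ i, |x i - x' i| + L * δ := by
  have hnorm : ‖x - x'‖ ≤ ∑ i, |x i - x' i| := by
    refine (pi_norm_le_iff_of_nonneg (Finset.sum_nonneg fun i _ => abs_nonneg _)).2 fun i => ?_
    exact Finset.single_le_sum (f := fun i => |x i - x' i|) (fun i _ => abs_nonneg _)
      (Finset.mem_univ i)
  have hterm : ∀ i, |∑ j, x j * A j i - ∑ j, x' j * A' j i|
      ≤ ∑ j, (|x j - x' j| * |A j i| + x' j * |A j i - A' j i|) := by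
    intro i
    rw [← Finset.sum_sub_distrib]
    refine (Finset.abs_sum_le_sum_abs _ _).trans (Finset.sum_le_sum fun j _ => ?_)
    have : x j * A j i - x' j * A' j i = (x j - x' j) * A j i + x' j * (A j i - A' j i) := by ring
    rw [this]
    refine (abs_add_le _ _).trans_eq ?_
    rw [abs_mul, abs_mul, abs_of_nonneg (hx'.1 j)]
  calc ∑ i, |∑ j, x j * A j i - ∑ j, x' j * A' j i|
      ≤ ∑ i, ∑ j, (|x j - x' j| * |A j i| + x' j * |A j i - A' j i|) :=
        Finset.sum_le_sum fun i _ => hterm i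
    _ = ∑ j, (|x j - x' j| * ∑ i, |A j i| + x' j * ∑ i, |A j i - A' j i|) := by
        rw [Finset.sum_comm]
        simp only [Finset.sum_add_distrib, Finset.mul_sum]
    _ ≤ ∑ j, (|x j - x' j| * C + x' j * (L * (‖x - x'‖ + δ))) := by
        refine Finset.sum_le_sum fun j _ => add_le_add ?_ ?_
        · exact mul_le_mul_of_nonneg_left (hA j) (abs_nonneg _)
        · exact mul_le_mul_of_nonneg_left (hAA' j) (hx'.1 j)
    _ = C * ∑ i, |x i - x' i| + L * (‖x - x'‖ + δ) := by
        rw [Finset.sum_add_distrib, ← Finset.sum_mul, ← Finset.sum_mul, hx'.2]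
        ring
    _ ≤ (C + L) * ∑ i, |x i - x' i| + L * δ := by
        nlinarith [mul_le_mul_of_nonneg_left hnorm hL]

theorem SolvesOn.continuousOn {S : ℕ} {m : ℝ → Fin S → ℝ} {A : ℝ → Fin S → Fin S → ℝ} {a b : ℝ}
    (hm : SolvesOn m A a b) (hab : a ≤ b) (i : Fin S) :
    ContinuousOn (fun t => m t i) (Set.Icc a b) := by
  have h := intervalIntegral.continuousOn_primitive_interval'
    (hm b (Set.right_mem_Icc.2 hab) i).1 Set.left_mem_uIcc
  rw [Set.uIcc_of_le hab] at h
  exact (continuousOn_const.add h).congr fun t ht => (hm t ht i).2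

/-- Stability of the linear forward equation in `ℓ¹`. -/
theorem SolvesOn.sum_abs_sub_le {S : ℕ} {m m' : ℝ → Fin S → ℝ} {A A' : ℝ → Fin S → Fin S → ℝ}
    {a b C L δ : ℝ} (hm : SolvesOn m A a b) (hm' : SolvesOn m' A' a b) (hab : a ≤ b)
    (hC : 0 ≤ C) (hL : 0 ≤ L) (hδ : 0 ≤ δ) (hs' : ∀ t ∈ Set.Icc a b, m' t ∈ simplex S)
    (hA : ∀ t ∈ Set.Icc a b, ∀ i, ∑ j, |A t i j| ≤ C)
    (hAA' : ∀ t ∈ Set.Icc a b, ∀ i, ∑ j, |A t i j - A' t i j| ≤ L * (‖m t - m' t‖ + δ)) :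
    ∑ i, |m b i - m' b i|
      ≤ Real.exp ((C + L) * (b - a)) * (∑ i, |m a i - m' a i| + L * δ * (b - a)) := by
  have hcont : ContinuousOn (fun t => ∑ i, |m t i - m' t i|) (Set.Icc a b) :=
    continuousOn_finsetSum _ fun i _ => ((hm.continuousOn hab i).sub (hm'.continuousOn hab i)).abs
  refine le_exp_mul_of_le_add_integral (f := fun t => ∑ i, |m t i - m' t i|) hab
    (add_nonneg hC hL) (mul_nonneg hL hδ) hcont fun t ht => ?_
  have hgint : ∀ i, IntervalIntegrable
      (fun s => |∑ j, m s j * A s j i - ∑ j, m' s j * A' s j i|) volume a t :=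
    fun i => ((hm t ht i).1.sub (hm' t ht i).1).abs
  have hterm : ∀ i, |m t i - m' t i| ≤ |m a i - m' a i|
      + ∫ s in a..t, |∑ j, m s j * A s j i - ∑ j, m' s j * A' s j i| := by
    intro i
    have hdiff : m t i - m' t i = (m a i - m' a i)
        + ∫ s in a..t, (∑ j, m s j * A s j i - ∑ j, m' s j * A' s j i) := by
      rw [intervalIntegral.integral_sub (hm t ht i).1 (hm' t ht i).1, (hm t ht i).2,
        (hm' t ht i).2]
      ring
    rw [hdiff]
    exact (abs_add_le _ _).trans (by
      gcongr
      exact intervalIntegral.abs_integral_le_integral_abs ht.1)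
  refine (Finset.sum_le_sum fun i _ => hterm i).trans ?_
  rw [Finset.sum_add_distrib, ← intervalIntegral.integral_finsetSum fun i _ => hgint i]
  refine add_le_add le_rfl (intervalIntegral.integral_mono_on ht.1 ?_ ?_ fun s hs => ?_)
  · have := IntervalIntegrable.sum Finset.univ fun i (_ : i ∈ Finset.univ) => hgint i
    simpa only [Finset.sum_fn] using this
  · refine ContinuousOn.intervalIntegrable ?_
    rw [Set.uIcc_of_le ht.1]
    exact ((continuousOn_const.mul hcont).add continuousOn_const).mono
      (Set.Icc_subset_Icc_right ht.2)
  · have hs : s ∈ Set.Icc a b := ⟨hs.1, hs.2.trans ht.2⟩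
    exact sum_abs_vecMul_sub_le hL (hs' s hs) (hA s hs) (hAA' s hs)

/-! ### Relocation -/

theorem relocate_mem_simplex_s8 {S : ℕ} (J : Fin S → Fin S) {x : Fin S → ℝ} (hx : x ∈ simplex S) :
    (fun j => ∑ i, if J i = j then x i else 0) ∈ simplex S := by
  refine ⟨fun j => Finset.sum_nonneg fun i _ => ?_, ?_⟩
  · split_ifs
    exacts [hx.1 i, le_rfl]
  · rw [Finset.sum_comm]
    simpa using hx.2

/-- Relocation is a contraction in `ℓ¹`. -/
theorem sum_abs_relocate_sub_le {S : ℕ} (J : Fin S → Fin S) (x x' : Fin S → ℝ) :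
    ∑ j, |(∑ i, if J i = j then x i else 0) - ∑ i, if J i = j then x' i else 0|
      ≤ ∑ i, |x i - x' i| := by
  have hterm : ∀ j, |(∑ i, if J i = j then x i else 0) - ∑ i, if J i = j then x' i else 0|
      ≤ ∑ i, if J i = j then |x i - x' i| else 0 := by
    intro j
    rw [← Finset.sum_sub_distrib]
    refine (Finset.abs_sum_le_sum_abs _ _).trans (Finset.sum_le_sum fun i _ => ?_)
    split_ifs <;> simp
  refine (Finset.sum_le_sum fun j _ => hterm j).trans_eq ?_
  rw [Finset.sum_comm]
  simp

/-! ### Shock histories -/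

theorem zu_eq_of_forall {n k : ℕ} {T : ℝ} {u : Fin n → ℝ} (hk : k ≤ n)
    (h1 : ∀ i : Fin n, (i : ℕ) < k → u i ∈ Set.Icc (0 : ℝ) T)
    (h2 : ∀ i : Fin n, k ≤ (i : ℕ) → u i = -1) : Zu u = k := by
  have hiff : ∀ i : Fin n, u i ≠ -1 ↔ (i : ℕ) < k := by
    intro i
    constructor
    · intro hi
      by_contra hlt
      exact hi (h2 i (not_lt.1 hlt))
    · intro hi heq
      have := (h1 i hi).1
      linarith
  unfold Zu
  simp only [hiff]
  rw [Fin.card_filter_val_lt]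
  exact min_eq_right hk

theorem memU.zu_spec {n : ℕ} {T : ℝ} {u : Fin n → ℝ} (hu : memU n T u) :
    Zu u ≤ n ∧ (∀ i : Fin n, (i : ℕ) < Zu u → u i ∈ Set.Icc (0 : ℝ) T) ∧
      (∀ i j : Fin n, (j : ℕ) < Zu u → i ≤ j → u i ≤ u j) ∧
      (∀ i : Fin n, Zu u ≤ (i : ℕ) → u i = -1) := by
  obtain ⟨k, hk, h1, h2, h3⟩ := hu
  rw [zu_eq_of_forall hk h1 h3]
  exact ⟨hk, h1, h2, h3⟩

theorem memU.exists_lastTime_eq {n : ℕ} {T : ℝ} {u : Fin n → ℝ} (hu : memU n T u)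
    (hz : 1 ≤ Zu u) : ∃ i : Fin n, (i : ℕ) + 1 = Zu u ∧ lastTime u = u i := by
  have hlt : Zu u - 1 < n := by have := hu.zu_spec.1; omega
  exact ⟨⟨Zu u - 1, hlt⟩, by simp only; omega, by rw [lastTime, dif_pos hlt]⟩

theorem memU.lastTime_mem {n : ℕ} {T : ℝ} {u : Fin n → ℝ} (hu : memU n T u)
    (hz : 1 ≤ Zu u) : lastTime u ∈ Set.Icc 0 T := by
  obtain ⟨i, hi, h⟩ := hu.exists_lastTime_eq hz
  exact h ▸ hu.zu_spec.2.1 i (by omega)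

theorem memU.le_lastTime {n : ℕ} {T : ℝ} {u : Fin n → ℝ} (hu : memU n T u)
    (hz : 1 ≤ Zu u) (j : Fin n) : u j ≤ lastTime u := by
  obtain ⟨i, hi, h⟩ := hu.exists_lastTime_eq hz
  by_cases hj : (j : ℕ) < Zu u
  · rw [h]
    exact hu.zu_spec.2.2.1 j i (by omega) (Fin.le_def.2 (by omega))
  · rw [hu.zu_spec.2.2.2 j (not_lt.1 hj)]
    linarith [(hu.lastTime_mem hz).1]

theorem startTime_eq_lastTime {n : ℕ} {u : Fin n → ℝ} (hz : 1 ≤ Zu u) :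
    startTime u = lastTime u := if_neg (by omega)

theorem memU.startTime_nonneg {n : ℕ} {T : ℝ} {u : Fin n → ℝ} (hu : memU n T u) :
    0 ≤ startTime u := by
  rcases Nat.eq_zero_or_pos (Zu u) with hz | hz
  · exact (if_pos hz).ge
  · rw [startTime_eq_lastTime hz]
    exact (hu.lastTime_mem hz).1

theorem memTS.startTime_le {n : ℕ} {T t : ℝ} {u : Fin n → ℝ} (h : memTS n T t u) :
    startTime u ≤ t := by
  rcases Nat.eq_zero_or_pos (Zu u) with hz | hz
  · exact (if_pos hz).trans_le h.2.1.1
  · obtain ⟨i, -, hi⟩ := h.1.exists_lastTime_eq hz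
    rw [startTime_eq_lastTime hz, hi]
    exact h.2.2 i

theorem memU.memTS {n : ℕ} {T t : ℝ} {u : Fin n → ℝ} (hu : memU n T u)
    (ht : t ∈ Set.Icc (startTime u) T) : MFGShocks.memTS n T t u := by
  refine ⟨hu, ⟨hu.startTime_nonneg.trans ht.1, ht.2⟩, fun i => ?_⟩
  rcases Nat.eq_zero_or_pos (Zu u) with hz | hz
  · rw [hu.zu_spec.2.2.2 i (by omega)]
    linarith [hu.startTime_nonneg, ht.1]
  · exact ((hu.le_lastTime hz i).trans_eq (startTime_eq_lastTime hz).symm).trans ht.1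

theorem memU.eq_const {n : ℕ} {T : ℝ} {u : Fin n → ℝ} (hu : memU n T u) (hz : Zu u = 0) :
    u = fun _ => -1 :=
  funext fun i => hu.zu_spec.2.2.2 i (by omega)

theorem memU.pop {n : ℕ} {T : ℝ} {u : Fin n → ℝ} (hu : memU n T u) (hz : 1 ≤ Zu u) :
    Zu (pop u) + 1 = Zu u ∧ MFGShocks.memTS n T (lastTime u) (MFGShocks.pop u) := by
  obtain ⟨hn, h1, h2, h3⟩ := hu.zu_spec
  have hlt : ∀ i : Fin n, (i : ℕ) < Zu u - 1 → MFGShocks.pop u i = u i :=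
    fun i hi => if_neg (by omega)
  have hge : ∀ i : Fin n, Zu u - 1 ≤ (i : ℕ) → MFGShocks.pop u i = -1 := by
    intro i hi
    by_cases hi' : (i : ℕ) + 1 = Zu u
    · exact if_pos hi'
    · exact (if_neg hi').trans (h3 i (by omega))
  have hmem : ∀ i : Fin n, (i : ℕ) < Zu u - 1 → MFGShocks.pop u i ∈ Set.Icc 0 T := by
    intro i hi
    rw [hlt i hi]
    exact h1 i (by omega)
  refine ⟨by rw [zu_eq_of_forall (by omega) hmem hge]; omega,
    ⟨Zu u - 1, by omega, hmem, fun i j hj hij => ?_, hge⟩, hu.lastTime_mem hz, fun i => ?_⟩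
  · rw [hlt j hj, hlt i (lt_of_le_of_lt (Fin.le_def.1 hij) hj)]
    exact h2 i j (by omega) hij
  · by_cases hi : (i : ℕ) < Zu u - 1
    · rw [hlt i hi]
      exact hu.le_lastTime hz i
    · rw [hge i (not_lt.1 hi)]
      linarith [(hu.lastTime_mem hz).1]

/-! ### Solutions of the forward system -/

theorem SolForward.solvesOn {S n : ℕ} {T t : ℝ} {D : Model S n}
    {v μ : ℝ → (Fin n → ℝ) → Fin S → ℝ} (hμ : SolForward S n T D v μ) {u : Fin n → ℝ}
    (hu : memTS n T t u) :
    SolvesOn (fun s => μ s u) (fun s => D.Q s u (μ s u) (v s u)) (startTime u) t :=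
  fun s hs i => hμ.2.2 u hu.1 s (hu.1.memTS ⟨hs.1, hs.2.trans hu.2.1.2⟩) i

theorem SolForward.relocate {S n : ℕ} {T : ℝ} {D : Model S n}
    {v μ : ℝ → (Fin n → ℝ) → Fin S → ℝ} (hμ : SolForward S n T D v μ) {u : Fin n → ℝ}
    (hu : memU n T u) (hz : 1 ≤ Zu u) :
    μ (startTime u) u
      = fun j => ∑ i, if D.J (lastTime u) i = j then μ (lastTime u) (pop u) i else 0 := by
  rw [startTime_eq_lastTime hz]
  exact funext fun j => hμ.2.1 u hu hz j

theorem SolForward.initial {S n : ℕ} {T : ℝ} {D : Model S n}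
    {v μ : ℝ → (Fin n → ℝ) → Fin S → ℝ} (hμ : SolForward S n T D v μ) {u : Fin n → ℝ}
    (hu : memU n T u) (hz : Zu u = 0) : μ (startTime u) u = D.m0 := by
  rw [startTime, if_pos hz, hu.eq_const hz]
  exact funext hμ.1

theorem SolForward.mem_simplex {S n : ℕ} {T : ℝ} {D : Model S n}
    {v μ : ℝ → (Fin n → ℝ) → Fin S → ℝ} (hμ : SolForward S n T D v μ)
    (hm0 : D.m0 ∈ simplex S) (hoff : ∀ t u m v i j, i ≠ j → 0 ≤ D.Q t u m v i j)
    (hrow : ∀ t u m v i, ∑ j, D.Q t u m v i j = 0) {t : ℝ} {u : Fin n → ℝ}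
    (hu : memTS n T t u) : μ t u ∈ simplex S := by
  induction hk : Zu u generalizing t u with
  | zero =>
    refine (hμ.solvesOn hu).mem_simplex hu.startTime_le (fun _ => hoff _ _ _ _)
      (fun _ => hrow _ _ _ _) ?_
    simpa only [hμ.initial hu.1 hk] using hm0
  | succ k ih =>
    have hz : 1 ≤ Zu u := by omega
    obtain ⟨hpz, hpop⟩ := hu.1.pop hz
    refine (hμ.solvesOn hu).mem_simplex hu.startTime_le (fun _ => hoff _ _ _ _)
      (fun _ => hrow _ _ _ _) ?_
    simpa only [hμ.relocate hu.1 hz] using relocate_mem_simplex_s8 _ (ih hpop (by omega))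

/-- The `ℓ¹`-distance of two forward solutions grows at most exponentially in time, irrespective
of the number of shocks. -/
theorem SolForward.sum_abs_sub_le {S n : ℕ} {T : ℝ} {D : Model S n} {C L δ : ℝ}
    {v v' μ μ' : ℝ → (Fin n → ℝ) → Fin S → ℝ} (hμ : SolForward S n T D v μ)
    (hμ' : SolForward S n T D v' μ') (hC : 0 ≤ C) (hL : 0 ≤ L) (hδ : 0 ≤ δ)
    (hm : ∀ t u, memTS n T t u → μ t u ∈ simplex S)
    (hm' : ∀ t u, memTS n T t u → μ' t u ∈ simplex S)
    (hbdd : ∀ t u m v, memTS n T t u → m ∈ simplex S → ∀ i, ∑ j, |D.Q t u m v i j| ≤ C)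
    (hlip : ∀ t u, memTS n T t u → ∀ m₁ ∈ simplex S, ∀ m₂ ∈ simplex S,
      ∀ v₁ v₂ : Fin S → ℝ, ∀ i,
        ∑ j, |D.Q t u m₁ v₁ i j - D.Q t u m₂ v₂ i j| ≤ L * (‖m₁ - m₂‖ + ‖v₁ - v₂‖))
    (hvv' : ∀ t u, memTS n T t u → ‖v t u - v' t u‖ ≤ δ) {t : ℝ} {u : Fin n → ℝ}
    (hu : memTS n T t u) :
    ∑ i, |μ t u i - μ' t u i| ≤ Real.exp ((C + L) * t) * (L * δ * t) := by
  have hstep : ∀ {t : ℝ} {u : Fin n → ℝ}, memTS n T t u →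
      ∑ i, |μ (startTime u) u i - μ' (startTime u) u i|
        ≤ Real.exp ((C + L) * startTime u) * (L * δ * startTime u) →
      ∑ i, |μ t u i - μ' t u i| ≤ Real.exp ((C + L) * t) * (L * δ * t) := by
    intro t u hu hstart
    have hts : ∀ s ∈ Set.Icc (startTime u) t, memTS n T s u :=
      fun s hs => hu.1.memTS ⟨hs.1, hs.2.trans hu.2.1.2⟩
    refine ((hμ.solvesOn hu).sum_abs_sub_le (hμ'.solvesOn hu) hu.startTime_le hC hL hδ
      (fun s hs => hm' s u (hts s hs))
      (fun s hs => hbdd s u _ _ (hts s hs) (hm s u (hts s hs)))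
      (fun s hs i => (hlip s u (hts s hs) _ (hm s u (hts s hs)) _ (hm' s u (hts s hs)) _ _
        i).trans ?_)).trans ?_
    · gcongr
      exact hvv' s u (hts s hs)
    · have ha := hu.1.startTime_nonneg
      have hat := hu.startTime_le
      set a := startTime u
      have h1 : 1 ≤ Real.exp ((C + L) * a) := Real.one_le_exp (by positivity)
      have h2 : L * δ * (t - a) ≤ Real.exp ((C + L) * a) * (L * δ * (t - a)) :=
        le_mul_of_one_le_left (mul_nonneg (mul_nonneg hL hδ) (sub_nonneg.2 hat)) h1
      calc _ ≤ Real.exp ((C + L) * (t - a)) * (Real.exp ((C + L) * a) * (L * δ * a)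
              + Real.exp ((C + L) * a) * (L * δ * (t - a))) := by gcongr
        _ = (Real.exp ((C + L) * (t - a)) * Real.exp ((C + L) * a)) * (L * δ * t) := by ring
        _ = Real.exp ((C + L) * t) * (L * δ * t) := by
            rw [← Real.exp_add]; congr 2; ring
  induction hk : Zu u generalizing t u with
  | zero =>
    refine hstep hu ?_
    rw [hμ.initial hu.1 hk, hμ'.initial hu.1 hk]
    have := hu.1.startTime_nonneg
    simp only [sub_self, abs_zero, Finset.sum_const_zero]
    positivity
  | succ k ih =>
    have hz : 1 ≤ Zu u := by omega
    obtain ⟨hpz, hpop⟩ := hu.1.pop hz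
    refine hstep hu ?_
    rw [hμ.relocate hu.1 hz, hμ'.relocate hu.1 hz, startTime_eq_lastTime hz]
    exact (sum_abs_relocate_sub_le _ _ _).trans (ih hpop (by omega))

theorem le_supTS {S n : ℕ} {T B : ℝ} {f : ℝ → (Fin n → ℝ) → Fin S → ℝ}
    (hB : ∀ t u, memTS n T t u → ‖f t u‖ ≤ B) {t : ℝ} {u : Fin n → ℝ} (hu : memTS n T t u) :
    ‖f t u‖ ≤ supTS S n T f := by
  refine le_csSup ⟨B, ?_⟩ ⟨t, u, hu, rfl⟩
  rintro r ⟨s, w, hw, rfl⟩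
  exact hB s w hw

theorem supTS_nonneg {S n : ℕ} {T : ℝ} (f : ℝ → (Fin n → ℝ) → Fin S → ℝ) :
    0 ≤ supTS S n T f := by
  refine Real.sSup_nonneg ?_
  rintro r ⟨t, u, -, rfl⟩
  exact norm_nonneg _

/-- **Lemma B.5** (Lipschitz continuity of the forward solution map `F⃗ : V → M`).
If `v, v̄ ∈ V` and `μ, μ̄` are the (unique) solutions of (E2), (E4), (E5) given `v`
and `v̄` respectively, then
`sup_{TS} ‖μ − μ̄‖ ≤ L_Q̂ T (Σ_{i=0}^{n} (e^{(Qmax+L_Q̂)T})^{i+1} Jmax^i) sup_{TS} ‖v − v̄‖`. -/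
theorem forward_solution_map_lipschitz (S n : ℕ) (T : ℝ) (D : Model S n)
    (Lpsi LQ LPsi Llam Psimax psimax Qmax lammax : ℝ) (Jmax : ℕ)
    (H : Hyps S n T D Lpsi LQ LPsi Llam Psimax psimax Qmax lammax Jmax)
    (v v' : ℝ → (Fin n → ℝ) → Fin S → ℝ)
    (hv : MemV S n T (vmaxC n T Psimax psimax Qmax lammax) v)
    (hv' : MemV S n T (vmaxC n T Psimax psimax Qmax lammax) v')
    (μ μ' : ℝ → (Fin n → ℝ) → Fin S → ℝ)
    (hμreg : Regular S n T μ) (hμ : SolForward S n T D v μ)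
    (hμ'reg : Regular S n T μ') (hμ' : SolForward S n T D v' μ') :
    supTS S n T (fun t u => μ t u - μ' t u) ≤
      LQ * T * (∑ i ∈ Finset.range (n + 1),
          (Real.exp ((Qmax + LQ) * T)) ^ (i + 1) * (Jmax : ℝ) ^ i) *
        supTS S n T (fun t u => v t u - v' t u) := by
  set δ := supTS S n T (fun t u => v t u - v' t u) with hδdef
  have hδ : 0 ≤ δ := supTS_nonneg _
  have hT := H.hT.le
  have hL := H.hLQ.le
  have hvv' : ∀ t u, memTS n T t u → ‖v t u - v' t u‖ ≤ δ := fun t u hu =>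
    le_supTS (f := fun t u => v t u - v' t u)
      (fun s w hw => (norm_sub_le _ _).trans (add_le_add (hv.2 s w hw) (hv'.2 s w hw))) hu
  have hC0 : 0 ≤ Qmax :=
    (Finset.sum_nonneg fun _ _ => abs_nonneg _).trans
      (H.Q_bdd 0 (fun _ => -1) D.m0 0
        ⟨⟨0, Nat.zero_le n, by simp, by simp, by simp⟩, ⟨le_rfl, hT⟩, by simp⟩ H.hm0 ⟨0, H.hS⟩)
  have hsum : Real.exp ((Qmax + LQ) * T) ≤ ∑ i ∈ Finset.range (n + 1),
      (Real.exp ((Qmax + LQ) * T)) ^ (i + 1) * (Jmax : ℝ) ^ i := by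
    have := Finset.single_le_sum
      (f := fun i => (Real.exp ((Qmax + LQ) * T)) ^ (i + 1) * (Jmax : ℝ) ^ i)
      (fun i _ => by positivity) (Finset.mem_range.2 n.succ_pos)
    simpa using this
  refine Real.sSup_le ?_ ?_
  · rintro r ⟨t, u, hu, rfl⟩
    have hl1 := hμ.sum_abs_sub_le hμ' hC0 hL hδ
      (fun t u hu => hμ.mem_simplex H.hm0 H.Q_offdiag H.Q_rowsum hu)
      (fun t u hu => hμ'.mem_simplex H.hm0 H.Q_offdiag H.Q_rowsum hu) H.Q_bdd H.Q_lip hvv' hu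
    have ht0 := hu.2.1.1
    have htT := hu.2.1.2
    calc ‖μ t u - μ' t u‖ ≤ ∑ i, |μ t u i - μ' t u i| := by
          refine (pi_norm_le_iff_of_nonneg
            (Finset.sum_nonneg fun i _ => abs_nonneg _)).2 fun i => ?_
          exact Finset.single_le_sum (f := fun i => |μ t u i - μ' t u i|)
            (fun i _ => abs_nonneg _) (Finset.mem_univ i)
      _ ≤ Real.exp ((Qmax + LQ) * t) * (LQ * δ * t) := hl1
      _ ≤ Real.exp ((Qmax + LQ) * T) * (LQ * δ * T) := by gcongr
      _ = LQ * T * Real.exp ((Qmax + LQ) * T) * δ := by ring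
      _ ≤ _ := by gcongr
  · positivity

end MFGShocks
end
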